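/- Let T > 0. Let h : ℝ × ℝ → ℝ be continuous, T-periodic in the first variable, and satisfy (h0) and (h1). Let a : ℝ → ℝ be a locally integrable T-periodic function satisfying (a#) and (a*). Let g : [0,+∞) → [0,+∞) be continuous, regularly oscillating at zero, satisfy (g*), and satisfy the superlinearity-at-zero condition: for every K ∈ ℝ, lim_{s→0⁺} h(t, K g(s))/s = 0 uniformly in t ∈ ℝ. Then there exists λ* > 0 such that for every λ > λ*, the system u' = h(t,v), v' = -λ a(t) g(u) has at least one T-periodic solution (u,v) with u(t) > 0 for all t ∈ ℝ. -/

import Mathlib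

open MeasureTheory Set Filter

noncomputable section

/-- `(u, v)` is a `T`-periodic solution of the planar system `u' = F t (v t)`,
`v' = G t (u t)`: both components are continuous, `T`-periodic, and are primitives
(in the sense of the integral form, equivalent to absolute continuity plus the
differential equations holding almost everywhere) of the right-hand sides. -/
def IsPeriodicSol (T : ℝ) (F G : ℝ → ℝ → ℝ) (u v : ℝ → ℝ) : Prop :=
  Continuous u ∧ Continuous v ∧
  Function.Periodic u T ∧ Function.Periodic v T ∧
  (∀ t₁ t₂ : ℝ, IntervalIntegrable (fun s => F s (v s)) volume t₁ t₂) ∧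
  (∀ t₁ t₂ : ℝ, IntervalIntegrable (fun s => G s (u s)) volume t₁ t₂) ∧
  (∀ t : ℝ, u t = u 0 + ∫ s in (0:ℝ)..t, F s (v s)) ∧
  (∀ t : ℝ, v t = v 0 + ∫ s in (0:ℝ)..t, G s (u s))

/-- Condition (a*): there are `N + 1 ≥ 1` pairwise disjoint closed intervals
`[σ n, τ n]` contained in a period, on which `a > 0` a.e., while `a ≤ 0` a.e.
on the rest of the period. -/
def SignChanging (T : ℝ) (a : ℝ → ℝ) (N : ℕ) (σ τ : Fin (N + 1) → ℝ) : Prop :=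
  (∀ n, σ n < τ n) ∧
  (∀ m n : Fin (N + 1), m < n → τ m < σ n) ∧
  (∀ n, τ n < σ 0 + T) ∧
  (∀ n, ∀ᵐ t ∂volume, t ∈ Set.Icc (σ n) (τ n) → 0 < a t) ∧
  (∀ᵐ t ∂volume, t ∈ Set.Ico (σ 0) (σ 0 + T) \ (⋃ n, Set.Icc (σ n) (τ n)) → a t ≤ 0)

/-- `g` is regularly oscillating at zero: `g (ω s) / g s → 1` as `s → 0⁺` and `ω → 1`. -/
def RegOscZero (g : ℝ → ℝ) : Prop :=
  Tendsto (fun p : ℝ × ℝ => g (p.1 * p.2) / g p.2)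
    ((nhds 1) ×ˢ (nhdsWithin 0 (Set.Ioi 0))) (nhds 1)

section Brouwer

open Metric

variable {E : Type*} [NormedAddCommGroup E] [InnerProductSpace ℝ E] [FiniteDimensional ℝ E]

/-- The determinant of `1 + A` is a fixed affine combination of the determinants of `1 + t • A`
for finitely many small parameters `t`. -/
theorem exists_det_interpolation (δ : ℝ) (hδ : 0 < δ) :
    ∃ (m : ℕ) (t L : ℕ → ℝ), (∀ i ∈ Finset.range m, 0 ≤ t i ∧ t i ≤ δ) ∧
      ∑ i ∈ Finset.range m, L i = 1 ∧
      ∀ A : E →L[ℝ] E, (1 + A).det = ∑ i ∈ Finset.range m, L i * (1 + t i • A).det := by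
  classical
  set d := Module.finrank ℝ E
  let b := Module.finBasis ℝ E
  let t : ℕ → ℝ := fun i => δ / (d + 1) * i
  have hd : (0 : ℝ) < d + 1 := by positivity
  have hinj : Set.InjOn t (Finset.range (d + 1)) := by
    intro i _ j _ hij
    have h0 : δ / ((d : ℝ) + 1) ≠ 0 := by positivity
    exact_mod_cast mul_left_cancel₀ h0 hij
  refine ⟨d + 1, t, fun i => (Lagrange.basis (Finset.range (d + 1)) t i).eval 1, ?_, ?_, ?_⟩
  · intro i hi
    refine ⟨by positivity, ?_⟩
    have hi' : (i : ℝ) ≤ d + 1 := by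
      have := Finset.mem_range.1 hi
      exact_mod_cast this.le
    calc t i ≤ δ / (d + 1) * (d + 1) := by
          exact mul_le_mul_of_nonneg_left hi' (by positivity)
      _ = δ := by field_simp
  · have := congrArg (Polynomial.eval 1) (Lagrange.sum_basis hinj (by simp))
    simpa [Polynomial.eval_finsetSum] using this
  · intro A
    let M := LinearMap.toMatrix b b (A : E →ₗ[ℝ] E)
    let Q : Polynomial ℝ := Matrix.det
      ((Polynomial.X : Polynomial ℝ) • M.map Polynomial.C
        + (1 : Matrix (Fin d) (Fin d) ℝ).map Polynomial.C)
    have hQ : ∀ s : ℝ, Q.eval s = (1 + s • A).det := by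
      intro s
      have h1 : (1 + s • A).det = LinearMap.det ((1 + s • A : E →L[ℝ] E) : E →ₗ[ℝ] E) := rfl
      rw [h1, ← LinearMap.det_toMatrix b]
      rw [← Polynomial.coe_evalRingHom, RingHom.map_det]
      congr 1
      ext i j
      simp [M, Matrix.map_apply, LinearMap.toMatrix_apply, Matrix.one_apply, b,
        Finsupp.single_apply, add_comm, eq_comm]
      split_ifs <;> simp [mul_comm]
    have hdeg : Q.degree < (Finset.range (d + 1)).card := by
      have := Polynomial.natDegree_det_X_add_C_le M 1
      rw [Finset.card_range]
      refine lt_of_le_of_lt Polynomial.degree_le_natDegree ?_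
      have h2 : Q.natDegree < d + 1 := by
        exact Nat.lt_succ_of_le (this.trans_eq (Fintype.card_fin d))
      exact_mod_cast h2
    have := congrArg (Polynomial.eval 1) (Lagrange.eq_interpolate hinj hdeg)
    rw [hQ, one_smul] at this
    rw [this, Lagrange.interpolate_apply, Polynomial.eval_finsetSum]
    refine Finset.sum_congr rfl fun i _ => ?_
    rw [Polynomial.eval_mul, Polynomial.eval_C, hQ, mul_comm]

/-- There is no continuously differentiable retraction of the closed unit ball onto the sphere. -/
theorem not_contDiffOn_retraction_sphere {r : E → E} {U : Set E} (hU : IsOpen U)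
    (hUB : closedBall 0 1 ⊆ U) (hr : ContDiffOn ℝ 1 r U)
    (hn : ∀ x ∈ closedBall (0 : E) 1, ‖r x‖ = 1) (hs : ∀ x : E, ‖x‖ = 1 → r x = x) : False := by
  borelize E
  let _ : MeasureSpace E := measureSpaceOfInnerProductSpace
  have hne : Nontrivial E := by
    refine ⟨r 0, 0, fun h0 => ?_⟩
    have := hn 0 (by simp)
    simp [h0] at this
  let D : E → E →L[ℝ] E := fun x => fderiv ℝ r x - 1
  have hrd : ∀ x ∈ closedBall (0 : E) 1, HasStrictFDerivAt r (fderiv ℝ r x) x := fun x hx =>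
    ((hr.contDiffAt (hU.mem_nhds (hUB hx))).hasStrictFDerivAt (by simp))
  let g : E → E := fun x => r x - x
  have hgd : ∀ x ∈ closedBall (0 : E) 1, HasStrictFDerivAt g (D x) x := fun x hx =>
    (hrd x hx).sub (hasStrictFDerivAt_id x)
  have hDc : ContinuousOn D (closedBall 0 1) := by
    have := (hr.continuousOn_fderiv_of_isOpen hU le_rfl).mono hUB
    exact this.sub continuousOn_const
  have hcomp : IsCompact (closedBall (0 : E) 1) := isCompact_closedBall 0 1
  obtain ⟨K, hK⟩ := hcomp.exists_bound_of_continuousOn hDc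
  have hK0 : 0 ≤ K := (norm_nonneg _).trans (hK 0 (by simp))
  have hlip : ∀ x ∈ closedBall (0 : E) 1, ∀ y ∈ closedBall (0 : E) 1,
      ‖g y - g x‖ ≤ K * ‖y - x‖ := fun x hx y hy =>
    (convex_closedBall (0 : E) 1).norm_image_sub_le_of_norm_hasFDerivWithin_le
      (fun z hz => (hgd z hz).hasFDerivAt.hasFDerivWithinAt) hK hx hy
  obtain ⟨ε, hε, hεdet⟩ : ∃ ε > 0, ∀ A : E →L[ℝ] E, ‖A‖ < ε → 0 < (1 + A).det := by
    have hc : Continuous fun A : E →L[ℝ] E => (1 + A).det :=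
      ContinuousLinearMap.continuous_det.comp (continuous_const.add continuous_id)
    have h1 : (0 : ℝ) < (1 + (0 : E →L[ℝ] E)).det := by
      rw [add_zero]
      have : (1 : E →L[ℝ] E).det = 1 := by
        change LinearMap.det (LinearMap.id : E →ₗ[ℝ] E) = 1
        simp
      rw [this]; exact one_pos
    have := hc.continuousAt.eventually (lt_mem_nhds h1)
    obtain ⟨ε, hε, h⟩ := Metric.eventually_nhds_iff.1 this
    exact ⟨ε, hε, fun A hA => h (by simpa using hA)⟩
  set δ := min 1 (min (1 / (2 * (K + 1))) (ε / (2 * (K + 1))))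
  have hδ : 0 < δ := by positivity
  have hδ1 : δ ≤ 1 := min_le_left _ _
  have hδK : δ * (2 * (K + 1)) ≤ 1 := by
    rw [← le_div_iff₀ (by positivity)]
    exact (min_le_right _ _).trans (min_le_left _ _)
  have hδε : δ * (2 * (K + 1)) ≤ ε := by
    rw [← le_div_iff₀ (by positivity)]
    exact (min_le_right _ _).trans (min_le_right _ _)
  have hvol : ∀ t : ℝ, 0 ≤ t → t ≤ δ →
      ∫ x in ball (0 : E) 1, (1 + t • D x).det = volume.real (ball (0 : E) 1) := by
    intro t ht0 htδ
    let φ : E → E := fun x => x + t • g x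
    have htK : t * K < 1 := by nlinarith [mul_le_mul_of_nonneg_right htδ hK0]
    have hdet : ∀ x ∈ closedBall (0 : E) 1, 0 < (1 + t • D x).det := by
      intro x hx
      apply hεdet
      rw [norm_smul, Real.norm_of_nonneg ht0]
      have := hK x hx
      nlinarith [mul_le_mul htδ this (norm_nonneg _) hδ.le]
    have hφd : ∀ x ∈ closedBall (0 : E) 1, HasStrictFDerivAt φ (1 + t • D x) x := fun x hx =>
      (hasStrictFDerivAt_id x).add ((hgd x hx).const_smul t)
    have hinj : InjOn φ (closedBall 0 1) := by
      intro x hx y hy hxy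
      by_contra hne
      have h1 : y - x = -(t • (g y - g x)) := by
        simp only [φ] at hxy
        rw [smul_sub]
        have : y - x = (x + t • g x) - x - (y + t • g y - y) := by rw [hxy]; abel
        rw [this]; abel
      have h2 : ‖y - x‖ ≤ t * (K * ‖y - x‖) := by
        conv_lhs => rw [h1, norm_neg, norm_smul, Real.norm_of_nonneg ht0]
        exact mul_le_mul_of_nonneg_left (hlip x hx y hy) ht0
      have h3 : 0 < ‖y - x‖ := norm_pos_iff.2 (sub_ne_zero.2 (Ne.symm hne))
      nlinarith
    have hmaps : ∀ x ∈ closedBall (0 : E) 1, φ x ∈ closedBall (0 : E) 1 := by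
      intro x hx
      have hrx : r x ∈ closedBall (0 : E) 1 := by simp [hn x hx]
      have : φ x = (1 - t) • x + t • r x := by
        simp only [φ, g, smul_sub, sub_smul, one_smul]; abel
      rw [this]
      exact convex_closedBall (0 : E) 1 hx hrx (by linarith) ht0 (by ring)
    have hopen : IsOpen (φ '' ball 0 1) := by
      rw [isOpen_iff_mem_nhds]
      rintro _ ⟨x, hx, rfl⟩
      have hxc := ball_subset_closedBall hx
      have hsurj : (1 + t • D x : E →L[ℝ] E).range = ⊤ := by
        rw [LinearMap.range_eq_top]
        exact (LinearEquiv.ofIsUnitDet (f := ((1 + t • D x : E →L[ℝ] E) : E →ₗ[ℝ] E))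
          (v := Module.finBasis ℝ E) (v' := Module.finBasis ℝ E)
          (by rw [LinearMap.det_toMatrix]; exact (hdet x hxc).ne'.isUnit)).surjective
      rw [← (hφd x hxc).map_nhds_eq_of_surj hsurj]
      exact image_mem_map (isOpen_ball.mem_nhds hx)
    have himage : φ '' ball 0 1 = ball 0 1 := by
      have hsub : φ '' ball 0 1 ⊆ ball 0 1 := by
        refine (interior_maximal ?_ hopen).trans (interior_closedBall (0 : E) one_ne_zero).subset
        rintro _ ⟨x, hx, rfl⟩
        exact hmaps x (ball_subset_closedBall hx)
      refine hsub.antisymm ?_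
      have hcl : IsClosed (φ '' closedBall 0 1) :=
        (hcomp.image_of_continuousOn fun x hx =>
          (hφd x hx).continuousAt.continuousWithinAt).isClosed
      refine (convex_ball (0 : E) 1).isPreconnected.subset_left_of_subset_union hopen
        hcl.isOpen_compl ?_ ?_ ?_
      · exact disjoint_compl_right_iff_subset.2 (image_mono ball_subset_closedBall)
      · intro y hy
        by_cases h : y ∈ φ '' closedBall 0 1
        · obtain ⟨x, hx, rfl⟩ := h
          left
          rcases lt_or_eq_of_le (mem_closedBall_zero_iff.1 hx) with h1 | h1
          · exact ⟨x, by simpa using h1, rfl⟩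
          · exfalso
            have : φ x = x := by simp [φ, g, hs x h1]
            rw [this, mem_ball_zero_iff, h1] at hy
            exact lt_irrefl _ hy
        · exact Or.inr h
      · exact ⟨φ 0, hsub ⟨0, by simp, rfl⟩, ⟨0, by simp, rfl⟩⟩
    have hcv := integral_image_eq_integral_abs_det_fderiv_smul volume
      (measurableSet_ball (x := (0 : E)) (ε := 1))
      (fun x hx => (hφd x (ball_subset_closedBall hx)).hasFDerivAt.hasFDerivWithinAt)
      (hinj.mono ball_subset_closedBall) (fun _ => (1 : ℝ))
    rw [himage] at hcv
    have h4 : ∫ x in ball (0 : E) 1, (1 : ℝ) = volume.real (ball (0 : E) 1) := by simp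
    rw [← h4, hcv]
    refine setIntegral_congr_fun measurableSet_ball fun x hx => ?_
    simp [abs_of_pos (hdet x (ball_subset_closedBall hx))]
  obtain ⟨m, t, L, ht, hL, hA⟩ := exists_det_interpolation (E := E) δ hδ
  have hint : ∀ s : ℝ, IntegrableOn (fun x => (1 + s • D x).det) (ball (0 : E) 1) := by
    intro s
    refine IntegrableOn.mono_set ?_ ball_subset_closedBall
    refine ContinuousOn.integrableOn_compact hcomp ?_
    exact ContinuousLinearMap.continuous_det.comp_continuousOn
      (continuousOn_const.add (hDc.const_smul s))
  have hone : ∫ x in ball (0 : E) 1, (1 + D x).det = volume.real (ball (0 : E) 1) := by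
    rw [funext fun x => hA (D x)]
    rw [integral_finsetSum _ fun i _ => (hint (t i)).const_mul (L i)]
    simp_rw [integral_const_mul]
    rw [Finset.sum_congr rfl fun i hi => by rw [hvol (t i) (ht i hi).1 (ht i hi).2],
      ← Finset.sum_mul, hL, one_mul]
  have hzero : ∫ x in ball (0 : E) 1, (1 + D x).det = 0 := by
    refine setIntegral_eq_zero_of_forall_eq_zero fun x hx => ?_
    have hxc := ball_subset_closedBall hx
    by_contra hdet
    have h1 : (1 : E →L[ℝ] E) + D x = fderiv ℝ r x := add_sub_cancel _ _
    rw [h1] at hdet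
    have hsurj : Function.Surjective (fderiv ℝ r x) :=
      (LinearEquiv.ofIsUnitDet (f := (fderiv ℝ r x : E →ₗ[ℝ] E))
        (v := Module.finBasis ℝ E) (v' := Module.finBasis ℝ E)
        (by rw [LinearMap.det_toMatrix]; exact (Ne.isUnit hdet))).surjective
    have hd := ((hrd x hxc).hasFDerivAt.norm_sq)
    have hconst : HasFDerivAt (fun y => ‖r y‖ ^ 2) (0 : E →L[ℝ] ℝ) x := by
      refine (hasFDerivAt_const (1 : ℝ) x).congr_of_eventuallyEq ?_
      filter_upwards [isOpen_ball.mem_nhds hx] with y hy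
      rw [hn y (ball_subset_closedBall hy), one_pow]
    have h2 := hd.unique hconst
    obtain ⟨w, hw⟩ := hsurj (r x)
    have h3 := congrArg (fun l : E →L[ℝ] ℝ => l w) h2
    simp [hw, hn x hxc] at h3
  have hpos : 0 < volume.real (ball (0 : E) 1) :=
    ENNReal.toReal_pos (measure_ball_pos volume 0 one_pos).ne' measure_ball_lt_top.ne
  linarith

/-- A continuously differentiable self-map of the closed unit ball has a fixed point. -/
theorem exists_fixedPoint_closedBall_of_contDiff {f : E → E} (hf : ContDiff ℝ 1 f)
    (hmaps : ∀ x ∈ closedBall (0 : E) 1, f x ∈ closedBall (0 : E) 1) :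
    ∃ x ∈ closedBall (0 : E) 1, f x = x := by
  by_contra! hfix
  let d : E → E := fun x => x - f x
  let p : E → ℝ := fun x => inner ℝ x (d x)
  let q : E → ℝ := fun x => p x ^ 2 + ‖d x‖ ^ 2 * (1 - ‖x‖ ^ 2)
  let s : E → ℝ := fun x => (-p x + √(q x)) / ‖d x‖ ^ 2
  let r : E → E := fun x => x + s x • d x
  have hd : ContDiff ℝ 1 d := contDiff_id.sub hf
  have hp : ContDiff ℝ 1 p := contDiff_id.inner ℝ hd
  have hq : ContDiff ℝ 1 q :=
    (hp.pow 2).add ((hd.norm_sq ℝ).mul (contDiff_const.sub (contDiff_id.norm_sq ℝ)))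
  let U : Set E := {x | d x ≠ 0} ∩ {x | 0 < q x}
  have hU : IsOpen U :=
    (isOpen_ne_fun hd.continuous continuous_const).inter
      (isOpen_lt continuous_const hq.continuous)
  have hd0 : ∀ x ∈ closedBall (0 : E) 1, d x ≠ 0 := fun x hx h =>
    hfix x hx (sub_eq_zero.1 h).symm
  have hp_pos : ∀ x : E, ‖x‖ = 1 → 0 < p x := by
    intro x hx
    have hxB : x ∈ closedBall (0 : E) 1 := by simp [hx]
    have h1 : 0 < ‖d x‖ := norm_pos_iff.2 (hd0 x hxB)
    have h2 : ‖f x‖ ≤ 1 := by simpa using hmaps x hxB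
    have h3 : ‖d x‖ ^ 2 = ‖x‖ ^ 2 - 2 * inner ℝ x (f x) + ‖f x‖ ^ 2 := norm_sub_sq_real _ _
    have h4 : p x = ‖x‖ ^ 2 - inner ℝ x (f x) := by
      simp only [p, d, inner_sub_right, real_inner_self_eq_norm_sq]
    rw [hx] at h3 h4
    nlinarith [norm_nonneg (f x)]
  have hq_pos : ∀ x ∈ closedBall (0 : E) 1, 0 < q x := by
    intro x hx
    have h1 : 0 < ‖d x‖ ^ 2 := by have := norm_pos_iff.2 (hd0 x hx); positivity
    rcases lt_or_eq_of_le (mem_closedBall_zero_iff.1 hx) with h | h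
    · have : 0 < 1 - ‖x‖ ^ 2 := by nlinarith [norm_nonneg x]
      have := mul_pos h1 this
      simp only [q]; positivity
    · have := hp_pos x h
      simp only [q, h]; norm_num; positivity
  refine not_contDiffOn_retraction_sphere (r := r) hU (fun x hx => ⟨hd0 x hx, hq_pos x hx⟩)
    ?_ ?_ ?_
  · refine contDiffOn_id.add (ContDiffOn.smul ?_ hd.contDiffOn)
    refine ContDiffOn.div (hp.contDiffOn.neg.add ?_) (hd.norm_sq ℝ).contDiffOn ?_
    · exact hq.contDiffOn.sqrt fun x hx => hx.2.ne'
    · exact fun x hx => by simpa using hx.1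
  · intro x hx
    have h1 : 0 < ‖d x‖ := norm_pos_iff.2 (hd0 x hx)
    have h2 : ‖r x‖ ^ 2 = ‖x‖ ^ 2 + 2 * (s x * p x) + (s x) ^ 2 * ‖d x‖ ^ 2 := by
      simp only [r, norm_add_sq_real, inner_smul_right, norm_smul, mul_pow, p,
        Real.norm_eq_abs, sq_abs]
    have h3 : s x * ‖d x‖ ^ 2 = -p x + √(q x) := by
      simp only [s]; field_simp
    have h4 : √(q x) ^ 2 = p x ^ 2 + ‖d x‖ ^ 2 * (1 - ‖x‖ ^ 2) := Real.sq_sqrt (hq_pos x hx).le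
    have h5 : ‖d x‖ ^ 2 * (‖r x‖ ^ 2 - 1) = 0 := by
      have h6 : √(q x) = s x * ‖d x‖ ^ 2 + p x := by linarith
      rw [h6] at h4
      rw [h2]
      linear_combination h4
    have h7 : ‖r x‖ ^ 2 = 1 := by
      have := (mul_eq_zero.1 h5).resolve_left (by positivity)
      linarith
    exact (pow_eq_one_iff_of_nonneg (norm_nonneg _) two_ne_zero).1 h7
  · intro x hx
    have h1 : q x = p x ^ 2 := by simp [q, hx]
    have h2 : s x = 0 := by
      simp only [s, h1, Real.sqrt_sq (hp_pos x hx).le]; simp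
    simp [r, h2]

/-- **Brouwer's fixed point theorem** for the closed unit ball. -/
theorem exists_fixedPoint_closedBall {f : E → E} (hf : Continuous f)
    (hmaps : ∀ x, f x ∈ closedBall (0 : E) 1) :
    ∃ x ∈ closedBall (0 : E) 1, f x = x := by
  by_contra! hfix
  obtain ⟨x₀, hx₀, hmin⟩ := (isCompact_closedBall (0 : E) 1).exists_isMinOn ⟨0, by simp⟩
    ((hf.sub continuous_id).norm.continuousOn)
  set δ := ‖f x₀ - x₀‖
  have hδ : 0 < δ := norm_pos_iff.2 (sub_ne_zero.2 (hfix x₀ hx₀))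
  obtain ⟨g, hg, hgf, -⟩ := hf.exists_contDiff_approx 1 (ε := fun _ => δ / 3)
    continuous_const (fun _ => by positivity)
  have hc : 0 < 1 + δ / 3 := by positivity
  have hgn : ∀ x, ‖g x‖ ≤ 1 + δ / 3 := by
    intro x
    have h1 := (hgf x).le
    rw [dist_eq_norm] at h1
    have h2 : ‖f x‖ ≤ 1 := by simpa using hmaps x
    calc ‖g x‖ = ‖f x + (g x - f x)‖ := by abel_nf
      _ ≤ ‖f x‖ + ‖g x - f x‖ := norm_add_le _ _
      _ ≤ _ := by linarith
  obtain ⟨x, hx, hxe⟩ := exists_fixedPoint_closedBall_of_contDiff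
    (f := fun x => (1 + δ / 3)⁻¹ • g x) (contDiff_const.smul hg) (by
      intro x _
      rw [mem_closedBall_zero_iff, norm_smul, norm_inv, Real.norm_of_nonneg hc.le,
        inv_mul_le_iff₀ hc, mul_one]
      exact hgn x)
  have h1 : g x = (1 + δ / 3) • x := by
    rw [← hxe, smul_inv_smul₀ hc.ne', hxe]
  have h2 : ‖f x - x‖ ≤ δ / 3 + δ / 3 := by
    have h3 : f x - x = -(g x - f x) + (δ / 3) • x := by
      rw [h1, add_smul, one_smul]; abel
    have h4 : ‖x‖ ≤ 1 := by simpa using hx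
    have h5 := (hgf x).le
    rw [dist_eq_norm] at h5
    rw [h3]
    refine (norm_add_le _ _).trans ?_
    rw [norm_neg, norm_smul, Real.norm_of_nonneg (by positivity)]
    nlinarith
  have h6 : δ ≤ ‖f x - x‖ := hmin hx
  linarith

/-- **Schauder's fixed point theorem** for compact convex subsets of a normed space. -/
theorem exists_fixedPoint_of_isCompact_of_convex {X : Type*} [NormedAddCommGroup X]
    [NormedSpace ℝ X] {K : Set X} (hK : IsCompact K) (hconv : Convex ℝ K) (hne : K.Nonempty)
    {F : X → X} (hF : ContinuousOn F K) (hmaps : MapsTo F K K) : ∃ x ∈ K, F x = x := by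
  classical
  by_contra! hfix
  obtain ⟨x₀, hx₀, hmin⟩ := hK.exists_isMinOn hne (hF.sub continuousOn_id).norm
  set δ := ‖F x₀ - x₀‖
  have hδ : 0 < δ := norm_pos_iff.2 (sub_ne_zero.2 (hfix x₀ hx₀))
  have hε : 0 < δ / 2 := by positivity
  obtain ⟨c, hcK, hcfin, hcover⟩ := hK.finite_cover_balls hε
  let _ : Fintype c := hcfin.fintype
  have hcne : Nonempty c := by
    obtain ⟨i, hi, -⟩ := mem_iUnion₂.1 (hcover hx₀)
    exact ⟨⟨i, hi⟩⟩
  let S : EuclideanSpace ℝ c → ℝ := fun y => ∑ i, max (y i) 0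
  let q : EuclideanSpace ℝ c → c → ℝ := fun y i =>
    (max (y i) 0 + max (1 - S y) 0 / Fintype.card c) / (S y + max (1 - S y) 0)
  have hScont : Continuous S := by fun_prop
  have hden : ∀ y, 1 ≤ S y + max (1 - S y) 0 := fun y => by
    linarith [le_max_left (1 - S y) 0]
  have hqcont : ∀ i, Continuous fun y => q y i := fun i =>
    Continuous.div (by fun_prop) (by fun_prop) fun y => by linarith [hden y]
  have hq0 : ∀ y i, 0 ≤ q y i := fun y i => div_nonneg (by positivity) (by linarith [hden y])
  have hq1 : ∀ y, ∑ i, q y i = 1 := by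
    intro y
    simp only [q]
    rw [← Finset.sum_div, Finset.sum_add_distrib, Finset.sum_const, Finset.card_univ,
      nsmul_eq_mul, mul_div_cancel₀ _ (by positivity)]
    exact div_self (by linarith [hden y])
  let G : EuclideanSpace ℝ c → X := fun y => ∑ i, q y i • (i : X)
  have hGK : ∀ y, G y ∈ K := fun y =>
    hconv.sum_mem (fun i _ => hq0 y i) (hq1 y) fun i _ => hcK i.2
  have hGcont : Continuous G := continuous_finsetSum _ fun i _ => (hqcont i).smul continuous_const
  let φ : X → c → ℝ := fun z i => max (δ / 2 - dist z i) 0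
  have hφcont : ∀ i, Continuous fun z => φ z i := fun i => by fun_prop
  have hφ0 : ∀ z i, 0 ≤ φ z i := fun z i => le_max_right _ _
  have hΦpos : ∀ z ∈ K, 0 < ∑ i, φ z i := by
    intro z hz
    obtain ⟨i, hi, hzi⟩ := mem_iUnion₂.1 (hcover hz)
    refine Finset.sum_pos' (fun j _ => hφ0 z j) ⟨⟨i, hi⟩, Finset.mem_univ _, ?_⟩
    exact lt_max_of_lt_left (sub_pos.2 hzi)
  have hFG : Continuous fun y => F (G y) :=
    hF.comp_continuous hGcont hGK
  let w : EuclideanSpace ℝ c → c → ℝ := fun y i => φ (F (G y)) i / ∑ j, φ (F (G y)) j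
  have hΦ : ∀ y, 0 < ∑ j, φ (F (G y)) j := fun y => hΦpos _ (hmaps (hGK y))
  have hw0 : ∀ y i, 0 ≤ w y i := fun y i => div_nonneg (hφ0 _ _) (hΦ y).le
  have hw1 : ∀ y, ∑ i, w y i = 1 := fun y => by
    simp only [w]; rw [← Finset.sum_div]; exact div_self (hΦ y).ne'
  have hwcont : Continuous w := continuous_pi fun i =>
    ((hφcont i).comp hFG).div (continuous_finsetSum _ fun j _ => (hφcont j).comp hFG)
      fun y => (hΦ y).ne'
  obtain ⟨y, -, hy⟩ := exists_fixedPoint_closedBall (f := fun y => WithLp.toLp 2 (w y))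
    ((PiLp.continuous_toLp 2 _).comp hwcont) (by
      intro y
      rw [mem_closedBall_zero_iff, EuclideanSpace.norm_eq, Real.sqrt_le_iff, one_pow]
      refine ⟨zero_le_one, ?_⟩
      calc ∑ i, ‖w y i‖ ^ 2 ≤ ∑ i, w y i := by
            refine Finset.sum_le_sum fun i _ => ?_
            have h1 : w y i ≤ 1 := by
              rw [← hw1 y]
              exact Finset.single_le_sum (fun j _ => hw0 y j) (Finset.mem_univ i)
            rw [Real.norm_of_nonneg (hw0 y i)]
            nlinarith [hw0 y i]
        _ = 1 := hw1 y)
  have hyw : ∀ i, y i = w y i := fun i => by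
    conv_lhs => rw [← hy]
  have hS : S y = 1 := by
    rw [← hw1 y]
    exact Finset.sum_congr rfl fun i _ => by rw [hyw i, max_eq_left (hw0 y i)]
  have hqy : ∀ i, q y i = w y i := fun i => by
    simp only [q, hS, sub_self, max_self, zero_div, add_zero, div_one]
    rw [hyw i, max_eq_left (hw0 y i)]
  set z := G y with hz
  have hdist : ‖F z - z‖ ≤ δ / 2 := by
    have h1 : F z - z = ∑ i, w y i • (F z - (i : X)) := by
      simp_rw [smul_sub]
      rw [Finset.sum_sub_distrib, ← Finset.sum_smul, hw1, one_smul, hz]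
      simp only [G, hqy]
    rw [h1]
    calc ‖∑ i, w y i • (F z - (i : X))‖ ≤ ∑ i, ‖w y i • (F z - (i : X))‖ := norm_sum_le _ _
      _ ≤ ∑ i, w y i * (δ / 2) := by
          refine Finset.sum_le_sum fun i _ => ?_
          rw [norm_smul, Real.norm_of_nonneg (hw0 y i)]
          rcases le_or_gt (dist (F z) i) (δ / 2) with h | h
          · rw [dist_eq_norm] at h
            exact mul_le_mul_of_nonneg_left h (hw0 y i)
          · have : w y i = 0 := by
              simp only [w, φ]
              rw [max_eq_right (by linarith), zero_div]
            simp [this]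
      _ = δ / 2 := by rw [← Finset.sum_mul, hw1, one_mul]
  have : δ ≤ ‖F z - z‖ := hmin (hGK y)
  linarith

end Brouwer

/-- A continuous periodic function attains its maximum. -/
theorem Function.Periodic.exists_forall_le {f : ℝ → ℝ} {T : ℝ} (hp : Function.Periodic f T)
    (hT : 0 < T) (hf : Continuous f) : ∃ t₀, ∀ t, f t ≤ f t₀ := by
  obtain ⟨t₀, -, h₀⟩ := isCompact_Icc.exists_isMaxOn (nonempty_Icc.2 hT.le) hf.continuousOn
  refine ⟨t₀, fun t => ?_⟩
  obtain ⟨s, hs, hst⟩ := hp.exists_mem_Ico₀ hT t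
  rw [hst]
  exact h₀ (Ico_subset_Icc_self hs)

/-- `T`-periodic solutions of `u' = h(t,v)`, `v' = -(λ a(t) G(u) + β a⁺(t))`. -/
structure IsForcedSol (T lam β : ℝ) (h : ℝ → ℝ → ℝ) (a G u v : ℝ → ℝ) : Prop where
  continuous_fst : Continuous u
  continuous_snd : Continuous v
  periodic_fst : Function.Periodic u T
  periodic_snd : Function.Periodic v T
  fst_sub : ∀ s t, u t - u s = ∫ x in s..t, h x (v x)
  snd_sub : ∀ s t, v t - v s = ∫ x in s..t, -(lam * (a x * G (u x)) + β * max (a x) 0)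

namespace IsForcedSol

variable {T lam β : ℝ} {h : ℝ → ℝ → ℝ} {a G u v : ℝ → ℝ}

theorem reverse (H : IsForcedSol T lam β h a G u v) :
    IsForcedSol T lam β (fun t s => -h (-t) (-s)) (fun t => a (-t)) G (fun t => u (-t))
      (fun t => -v (-t)) where
  continuous_fst := H.continuous_fst.comp continuous_neg
  continuous_snd := (H.continuous_snd.comp continuous_neg).neg
  periodic_fst := fun t => by
    have := H.periodic_fst (-(t + T)); simp only; rw [← this]; congr 1; ring
  periodic_snd := fun t => by
    have := H.periodic_snd (-(t + T)); simp only; rw [← this]; congr 2; ring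
  fst_sub := fun s t => by
    have h1 := intervalIntegral.integral_comp_neg (a := s) (b := t) fun x => -h x (v x)
    simp only [neg_neg]
    rw [h1, intervalIntegral.integral_neg, ← H.fst_sub]
    ring
  snd_sub := fun s t => by
    have h1 := intervalIntegral.integral_comp_neg (a := s) (b := t)
      fun x => -(lam * (a x * G (u x)) + β * max (a x) 0)
    rw [h1, ← H.snd_sub]
    ring

theorem intervalIntegrable_fst (H : IsForcedSol T lam β h a G u v)
    (hhc : Continuous (Function.uncurry h)) (s t : ℝ) :
    IntervalIntegrable (fun x => h x (v x)) volume s t :=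
  (hhc.comp (continuous_id.prodMk H.continuous_snd)).intervalIntegrable s t

theorem hasDerivAt_fst (H : IsForcedSol T lam β h a G u v)
    (hhc : Continuous (Function.uncurry h)) (t : ℝ) : HasDerivAt u (h t (v t)) t := by
  have hc : Continuous fun x => h x (v x) := hhc.comp (continuous_id.prodMk H.continuous_snd)
  have h1 := (hc.integral_hasStrictDerivAt 0 t).hasDerivAt.const_add (u 0)
  refine h1.congr_of_eventuallyEq (Eventually.of_forall fun s => ?_)
  have := H.fst_sub 0 s
  simp only; linarith

theorem snd_eq_zero_of_isLocalExtr (H : IsForcedSol T lam β h a G u v)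
    (hhc : Continuous (Function.uncurry h)) (hh0 : ∀ t, h t 0 = 0) (hh1 : ∀ t, StrictMono (h t))
    {t : ℝ} (ht : IsLocalExtr u t) : v t = 0 :=
  (hh1 t).injective ((ht.hasDerivAt_eq_zero (H.hasDerivAt_fst hhc t)).trans (hh0 t).symm)

theorem fst_le_of_snd_nonpos (H : IsForcedSol T lam β h a G u v)
    (hh0 : ∀ t, h t 0 = 0) (hh1 : ∀ t, StrictMono (h t)) {s t : ℝ} (hst : s ≤ t)
    (hv : ∀ x ∈ Icc s t, v x ≤ 0) : u t ≤ u s := by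
  have h1 : 0 ≤ ∫ x in s..t, -h x (v x) :=
    intervalIntegral.integral_nonneg hst fun x hx => by
      have := (hh1 x).monotone (hv x hx)
      rw [hh0] at this; linarith
  rw [intervalIntegral.integral_neg, ← H.fst_sub] at h1
  linarith

theorem intervalIntegrable_mul_comp (H : IsForcedSol T lam β h a G u v)
    (ha : ∀ s t, IntervalIntegrable a volume s t) (hG : Continuous G) (s t : ℝ) :
    IntervalIntegrable (fun x => a x * G (u x)) volume s t :=
  (ha s t).mul_continuousOn (hG.comp H.continuous_fst).continuousOn

theorem intervalIntegrable_snd (H : IsForcedSol T lam β h a G u v)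
    (ha : ∀ s t, IntervalIntegrable a volume s t) (hG : Continuous G) (s t : ℝ) :
    IntervalIntegrable (fun x => -(lam * (a x * G (u x)) + β * max (a x) 0)) volume s t := by
  have h1 : IntervalIntegrable (fun x => max (a x) 0) volume s t :=
    ⟨(ha s t).1.pos_part, (ha s t).2.pos_part⟩
  exact (((H.intervalIntegrable_mul_comp ha hG s t).const_mul lam).add (h1.const_mul β)).neg

/-- The forcing coefficient is determined by integrating the second equation over a period. -/
theorem forcing_mul_eq (H : IsForcedSol T lam β h a G u v)
    (ha : ∀ s t, IntervalIntegrable a volume s t) (hG : Continuous G) :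
    β * ∫ x in (0 : ℝ)..T, max (a x) 0 = -(lam * ∫ x in (0 : ℝ)..T, a x * G (u x)) := by
  have h1 := H.snd_sub 0 T
  have hp : IntervalIntegrable (fun x => max (a x) 0) volume 0 T :=
    ⟨(ha 0 T).1.pos_part, (ha 0 T).2.pos_part⟩
  have h2 : v T = v 0 := by simpa using H.periodic_snd 0
  rw [h2, sub_self, intervalIntegral.integral_neg, intervalIntegral.integral_add
    ((H.intervalIntegrable_mul_comp ha hG 0 T).const_mul lam) (hp.const_mul β),
    intervalIntegral.integral_const_mul, intervalIntegral.integral_const_mul] at h1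
  linarith

/-- The maximum principle: with nonnegative forcing, a solution that is positive somewhere is
nonnegative. -/
theorem fst_nonneg (H : IsForcedSol T lam β h a G u v) (hT : 0 < T)
    (hhc : Continuous (Function.uncurry h)) (hh0 : ∀ t, h t 0 = 0) (hh1 : ∀ t, StrictMono (h t))
    (hG0 : ∀ x ≤ 0, G x = 0) (hβ : 0 ≤ β) {tp : ℝ} (htp : 0 < u tp) (t : ℝ) : 0 ≤ u t := by
  have hup := H.periodic_fst
  obtain ⟨t₁, ht₁⟩ : ∃ t₁, ∀ t, u t₁ ≤ u t := by
    have hneg : Function.Periodic (fun t => -u t) T := fun t => by simp [hup t]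
    obtain ⟨t₁, h⟩ := hneg.exists_forall_le hT H.continuous_fst.neg
    exact ⟨t₁, fun t => neg_le_neg_iff.1 (h t)⟩
  by_contra! hneg
  have hu₁ : u t₁ < 0 := (ht₁ t).trans_lt hneg
  have hv₁ : v t₁ = 0 := H.snd_eq_zero_of_isLocalExtr hhc hh0 hh1
    (Or.inl (Eventually.of_forall ht₁))
  obtain ⟨s, hs, hsu⟩ := hup.exists_mem_Ico hT tp t₁
  have hc : IsClosed {x | t₁ ≤ x ∧ 0 ≤ u x} :=
    (isClosed_le continuous_const continuous_id).inter
      (isClosed_le continuous_const H.continuous_fst)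
  have hbdd : BddBelow {x | t₁ ≤ x ∧ 0 ≤ u x} := ⟨t₁, fun x hx => hx.1⟩
  have hmem := hc.csInf_mem ⟨s, hs.1, by rw [← hsu]; exact htp.le⟩ hbdd
  set t₂ := sInf {x | t₁ ≤ x ∧ 0 ≤ u x}
  have hlt : ∀ x, t₁ ≤ x → x < t₂ → u x < 0 := fun x hx hx2 => by
    by_contra! h
    exact absurd (csInf_le hbdd ⟨hx, h⟩) (not_le.2 hx2)
  have hv : ∀ x ∈ Icc t₁ t₂, v x ≤ 0 := by
    intro x hx
    have h1 : ∫ y in t₁..x, -(lam * (a y * G (u y)) + β * max (a y) 0)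
        = ∫ y in t₁..x, -(β * max (a y) 0) := by
      refine intervalIntegral.integral_congr_Ioo_of_le hx.1 fun y hy => ?_
      simp [hG0 _ (hlt y hy.1.le (hy.2.trans_le hx.2)).le]
    have h2 := H.snd_sub t₁ x
    have h3 : 0 ≤ ∫ y in t₁..x, β * max (a y) 0 :=
      intervalIntegral.integral_nonneg hx.1 fun y _ => by positivity
    rw [h1, intervalIntegral.integral_neg, hv₁] at h2
    linarith
  have := H.fst_le_of_snd_nonpos hh0 hh1 hmem.1 hv
  linarith [hmem.2]

end IsForcedSol

namespace IsForcedSol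

variable {T lam β : ℝ} {h : ℝ → ℝ → ℝ} {a G u v : ℝ → ℝ}

theorem abs_snd_sub_le (H : IsForcedSol T lam β h a G u v)
    (ha : ∀ s t, IntervalIntegrable a volume s t) (hap : Function.Periodic a T) (hlam : 0 ≤ lam)
    {s t γ : ℝ} (hst : s ≤ t) (htT : t ≤ s + T) (hγ : ∀ x ∈ Icc s t, |G (u x)| ≤ γ) :
    |v t - v s| ≤ lam * γ * (∫ x in (0 : ℝ)..T, |a x|)
      + |β| * ∫ x in (0 : ℝ)..T, max (a x) 0 := by
  have hp : ∀ s t, IntervalIntegrable (fun x => max (a x) 0) volume s t := fun s t =>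
    ⟨(ha s t).1.pos_part, (ha s t).2.pos_part⟩
  have hγ0 : 0 ≤ γ := (abs_nonneg _).trans (hγ s (left_mem_Icc.2 hst))
  have hpa : Function.Periodic (fun x => |a x|) T := fun x => by simp [hap x]
  have hpp : Function.Periodic (fun x => max (a x) 0) T := fun x => by simp [hap x]
  have hint : ∀ s t, IntervalIntegrable
      (fun x => lam * γ * |a x| + |β| * max (a x) 0) volume s t := fun s t =>
    ((ha s t).abs.const_mul _).add ((hp s t).const_mul _)
  calc |v t - v s| ≤ ∫ x in s..t, (lam * γ * |a x| + |β| * max (a x) 0) := by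
        rw [H.snd_sub, ← Real.norm_eq_abs]
        refine intervalIntegral.norm_integral_le_of_norm_le hst (ae_of_all _ fun x hx => ?_)
          (hint s t)
        rw [norm_neg, Real.norm_eq_abs]
        refine (abs_add_le _ _).trans (add_le_add ?_ ?_)
        · rw [abs_mul, abs_mul, abs_of_nonneg hlam, mul_comm |a x|, mul_assoc]
          have := hγ x (Ioc_subset_Icc_self hx)
          gcongr
        · rw [abs_mul, abs_of_nonneg (le_max_right (a x) 0)]
    _ ≤ ∫ x in s..s + T, (lam * γ * |a x| + |β| * max (a x) 0) :=
        intervalIntegral.integral_mono_interval le_rfl hst htT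
          (ae_of_all _ fun x => by positivity) (hint _ _)
    _ = _ := by
        rw [intervalIntegral.integral_add ((ha _ _).abs.const_mul _) ((hp _ _).const_mul _),
          intervalIntegral.integral_const_mul, intervalIntegral.integral_const_mul,
          hpa.intervalIntegral_add_eq s 0, hpp.intervalIntegral_add_eq s 0, zero_add]

/-- Superlinearity at zero prevents nontrivial nonnegative unforced solutions from vanishing. -/
theorem fst_pos (H : IsForcedSol T lam 0 h a G u v) (hT : 0 < T)
    (hhc : Continuous (Function.uncurry h)) (hh0 : ∀ t, h t 0 = 0) (hh1 : ∀ t, StrictMono (h t))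
    (ha : ∀ s t, IntervalIntegrable a volume s t) (hap : Function.Periodic a T)
    (hlam : 0 ≤ lam) (hG : Continuous G) (hG0 : G 0 = 0) (hGpos : ∀ x, 0 < x → 0 < G x)
    (hzero : ∀ K ε : ℝ, 0 < ε → ∃ s₀ > 0, ∀ s, 0 < s → s < s₀ → ∀ t, |h t (K * G s)| ≤ ε * s)
    (hu0 : ∀ t, 0 ≤ u t) {tp : ℝ} (htp : 0 < u tp) (t : ℝ) : 0 < u t := by
  by_contra! hneg
  have ht : u t = 0 := le_antisymm hneg (hu0 t)
  obtain ⟨p, hp, hpu⟩ := H.periodic_fst.exists_mem_Ico hT tp t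
  rw [hpu] at htp
  have hc : IsClosed {x | x ≤ p ∧ u x = 0} :=
    (isClosed_le continuous_id continuous_const).inter
      (isClosed_eq H.continuous_fst continuous_const)
  have hbdd : BddAbove {x | x ≤ p ∧ u x = 0} := ⟨p, fun x hx => hx.1⟩
  have hmem := hc.csSup_mem ⟨t, hp.1, ht⟩ hbdd
  set q := sSup {x | x ≤ p ∧ u x = 0}
  have hqp : q < p := lt_of_le_of_ne hmem.1 fun e => by
    have := hmem.2
    rw [e] at this; linarith
  have hpos : ∀ x, q < x → x ≤ p → 0 < u x := fun x hx hx2 =>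
    lt_of_le_of_ne (hu0 x) fun e => absurd (le_csSup hbdd ⟨hx2, e.symm⟩) (not_le.2 hx)
  have hvq : v q = 0 := H.snd_eq_zero_of_isLocalExtr hhc hh0 hh1
    (Or.inl (Eventually.of_forall fun x => hmem.2.le.trans (hu0 x)))
  set A := ∫ x in (0 : ℝ)..T, |a x|
  obtain ⟨s₀, hs₀, hsmall⟩ := hzero (lam * A) (1 / (2 * T)) (by positivity)
  have hev : ∀ᶠ x in nhds q, u x < s₀ :=
    H.continuous_fst.continuousAt.eventually_lt continuousAt_const (by rw [hmem.2]; exact hs₀)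
  obtain ⟨δ, hδ, hδu⟩ := Metric.eventually_nhds_iff.1 hev
  set d := min (min (δ / 2) T) (p - q)
  have hd : 0 < d := lt_min (lt_min (by positivity) hT) (by linarith)
  have hdT : d ≤ T := (min_le_left _ _).trans (min_le_right _ _)
  have hdδ : d ≤ δ / 2 := (min_le_left _ _).trans (min_le_left _ _)
  have hdp : d ≤ p - q := min_le_right _ _
  obtain ⟨m, hm, hmax⟩ := (isCompact_Icc (a := q) (b := q + d)).exists_isMaxOn
    (nonempty_Icc.2 (by linarith)) H.continuous_fst.continuousOn
  have hum : 0 < u m := (hpos (q + d) (by linarith) (by linarith)).trans_le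
    (hmax (right_mem_Icc.2 (by linarith)))
  have hums : u m < s₀ := hδu (by
    rw [Real.dist_eq, abs_of_nonneg (by linarith [hm.1])]; linarith [hm.2])
  obtain ⟨r, hr, hrmax⟩ := (isCompact_Icc (a := 0) (b := u m)).exists_isMaxOn
    (nonempty_Icc.2 hum.le) hG.continuousOn
  have hGr : 0 < G r := (hGpos _ hum).trans_le (hrmax (right_mem_Icc.2 hum.le))
  have hr0 : 0 < r := lt_of_le_of_ne hr.1 fun e => by rw [← e, hG0] at hGr; exact hGr.false
  have hGle : ∀ x ∈ Icc q m, |G (u x)| ≤ G r := fun x hx => by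
    have h1 : u x ∈ Icc 0 (u m) := ⟨hu0 x, hmax ⟨hx.1, hx.2.trans hm.2⟩⟩
    rw [abs_of_nonneg]
    · exact hrmax h1
    · rcases h1.1.eq_or_lt with e | e
      · rw [← e, hG0]
      · exact (hGpos _ e).le
  have hv : ∀ x ∈ Icc q m, h x (v x) ≤ 1 / (2 * T) * r := fun x hx => by
    have h1 := H.abs_snd_sub_le ha hap hlam hx.1 (by linarith [hx.2, hm.2])
      fun y hy => hGle y ⟨hy.1, hy.2.trans hx.2⟩
    rw [hvq, sub_zero, abs_zero, zero_mul, add_zero] at h1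
    refine le_trans ?_ ((le_abs_self _).trans (hsmall r hr0 (hr.2.trans_lt hums) x))
    refine (hh1 x).monotone (((le_abs_self _).trans h1).trans_eq ?_)
    ring
  have h2 : u m - u q ≤ ∫ _x in q..m, 1 / (2 * T) * r := by
    rw [H.fst_sub]
    exact intervalIntegral.integral_mono_on hm.1 (H.intervalIntegrable_fst hhc _ _)
      intervalIntegrable_const hv
  rw [intervalIntegral.integral_const, smul_eq_mul, hmem.2, sub_zero] at h2
  have h3 : (m - q) * (1 / (2 * T) * r) ≤ T * (1 / (2 * T) * r) := by
    have : m - q ≤ T := by linarith [hm.2]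
    gcongr
  have h4 : T * (1 / (2 * T) * r) = r / 2 := by field_simp
  linarith [hr.2]

/-- Small norm: a solution whose maximum is exactly `r` must have positive forcing. -/
theorem exists_small (hT : 0 < T)
    (hhc : Continuous (Function.uncurry h)) (hh0 : ∀ t, h t 0 = 0) (hh1 : ∀ t, StrictMono (h t))
    (ha : ∀ s t, IntervalIntegrable a volume s t) (hap : Function.Periodic a T)
    (haneg : ∫ x in (0 : ℝ)..T, a x < 0) (hapos : 0 < ∫ x in (0 : ℝ)..T, max (a x) 0)
    (hlam : 0 < lam) (hG : Continuous G) (hG0 : ∀ x ≤ 0, G x = 0) (hGpos : ∀ x, 0 < x → 0 < G x)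
    (hzero : ∀ K ε : ℝ, 0 < ε → ∃ s₀ > 0, ∀ s, 0 < s → s < s₀ → ∀ t, |h t (K * G s)| ≤ ε * s)
    (hosc : ∀ η > 0, ∃ δ > 0, ∃ s₁ > 0, ∀ r, 0 < r → r < s₁ → ∀ x, (1 - δ) * r ≤ x → x ≤ r →
      |G x - G r| ≤ η * G r) {R : ℝ} (hR : 0 < R) :
    ∃ r, 0 < r ∧ r < R ∧ ∀ β u v, IsForcedSol T lam β h a G u v → (∀ t, u t ≤ r) →
      (∃ t, u t = r) → 0 < β := by
  set A := ∫ x in (0 : ℝ)..T, |a x|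
  set I := ∫ x in (0 : ℝ)..T, a x
  set P := ∫ x in (0 : ℝ)..T, max (a x) 0
  have hGnn : ∀ x, 0 ≤ G x := fun x => by
    rcases le_or_gt x 0 with e | e
    · rw [hG0 x e]
    · exact (hGpos x e).le
  have hA : 0 < A := by
    have : |I| ≤ A := intervalIntegral.abs_integral_le_integral_abs hT.le
    exact (abs_pos.2 haneg.ne).trans_le this
  obtain ⟨δ, hδ, s₁, hs₁, hosc⟩ := hosc (-I / (2 * A)) (by
    have : 0 < -I := by linarith
    positivity)
  set e := δ / T
  have he : 0 < e := by positivity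
  have heT : T * e = δ := by simp only [e]; field_simp
  obtain ⟨s₂, hs₂, hz₂⟩ := hzero (2 * lam * A) e he
  obtain ⟨s₃, hs₃, hz₃⟩ := hzero (-(2 * lam * A)) e he
  set b := min (min s₁ s₂) (min s₃ R) / 2
  have hb : 0 < b := by positivity
  have hbm : b < min (min s₁ s₂) (min s₃ R) := half_lt_self (by positivity)
  have hb1 : b < s₁ := hbm.trans_le ((min_le_left _ _).trans (min_le_left _ _))
  have hb2 : b < s₂ := hbm.trans_le ((min_le_left _ _).trans (min_le_right _ _))
  have hb3 : b < s₃ := hbm.trans_le ((min_le_right _ _).trans (min_le_left _ _))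
  have hbR : b < R := hbm.trans_le ((min_le_right _ _).trans (min_le_right _ _))
  obtain ⟨r, hr, hrmax⟩ := (isCompact_Icc (a := 0) (b := b)).exists_isMaxOn
    (nonempty_Icc.2 hb.le) hG.continuousOn
  have hGr : 0 < G r := (hGpos _ hb).trans_le (hrmax (right_mem_Icc.2 hb.le))
  have hr0 : 0 < r := lt_of_le_of_ne hr.1 fun e => by
    rw [← e, hG0 0 le_rfl] at hGr; exact hGr.false
  refine ⟨r, hr0, hr.2.trans_lt hbR, fun β u v H hur ⟨t₀, ht₀⟩ => ?_⟩
  have hGle : ∀ x, |G (u x)| ≤ G r := fun x => by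
    rw [abs_of_nonneg (hGnn _)]
    rcases le_or_gt (u x) 0 with e | e
    · rw [hG0 _ e]; exact hGr.le
    · exact hrmax ⟨e.le, (hur x).trans hr.2⟩
  have hGu := hG.comp H.continuous_fst
  have hβ : |β| * P ≤ lam * (G r * A) := by
    have h1 : |∫ x in (0 : ℝ)..T, a x * G (u x)| ≤ G r * A := by
      rw [← Real.norm_eq_abs, ← intervalIntegral.integral_const_mul]
      refine intervalIntegral.norm_integral_le_of_norm_le hT.le (ae_of_all _ fun x _ => ?_)
        ((ha 0 T).abs.const_mul _)
      rw [Real.norm_eq_abs, abs_mul, mul_comm]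
      have := hGle x
      gcongr
    have h2 := congrArg abs (H.forcing_mul_eq ha hG)
    rw [abs_mul, abs_of_pos hapos, abs_neg, abs_mul, abs_of_pos hlam] at h2
    rw [h2]; gcongr
  have hv₀ : v t₀ = 0 := H.snd_eq_zero_of_isLocalExtr hhc hh0 hh1
    (Or.inr (Eventually.of_forall fun x => (hur x).trans_eq ht₀.symm))
  have hv : ∀ x ∈ Icc t₀ (t₀ + T), |h x (v x)| ≤ e * r := fun x hx => by
    have h1 := H.abs_snd_sub_le ha hap hlam.le hx.1 hx.2 fun y _ => hGle y
    rw [hv₀, sub_zero] at h1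
    have h2 : |v x| ≤ 2 * lam * A * G r := by linarith
    rw [abs_le] at h2
    have h3 := (abs_le.1 (hz₂ r hr0 (hr.2.trans_lt hb2) x)).2
    have h4 := (abs_le.1 (hz₃ r hr0 (hr.2.trans_lt hb3) x)).1
    rw [neg_mul] at h4
    exact abs_le.2 ⟨h4.trans ((hh1 x).monotone h2.1), ((hh1 x).monotone h2.2).trans h3⟩
  have hu : ∀ x ∈ Icc t₀ (t₀ + T), (1 - δ) * r ≤ u x := fun x hx => by
    have h1 : ‖u x - u t₀‖ ≤ e * r * |x - t₀| := by
      rw [H.fst_sub]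
      refine intervalIntegral.norm_integral_le_of_norm_le_const fun y hy => ?_
      rw [uIoc_of_le hx.1] at hy
      exact hv y ⟨hy.1.le, hy.2.trans hx.2⟩
    rw [abs_of_nonneg (by linarith [hx.1]), Real.norm_eq_abs, ht₀] at h1
    have h2 : e * r * (x - t₀) ≤ e * r * T := by
      have : x - t₀ ≤ T := by linarith [hx.2]
      gcongr
    have h3 : T * e * r = δ * r := by rw [heT]
    have := (abs_le.1 h1).1
    nlinarith
  have hper : Function.Periodic (fun x => a x * G (u x)) T := fun x => by
    simp only [hap x, H.periodic_fst x]
  have hia := H.intervalIntegrable_mul_comp ha hG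
  have hdiff : ∫ x in t₀..t₀ + T, (a x * G (u x) - a x * G r) ≤ -I / (2 * A) * G r * A := by
    have h1 : A = ∫ x in t₀..t₀ + T, |a x| := by
      have hpa : Function.Periodic (fun x => |a x|) T := fun x => by simp [hap x]
      rw [hpa.intervalIntegral_add_eq t₀ 0, zero_add]
    rw [h1, ← intervalIntegral.integral_const_mul, ← h1]
    refine intervalIntegral.integral_mono_on (by linarith)
      ((hia _ _).sub ((ha _ _).mul_const _)) ((ha _ _).abs.const_mul _) fun x hx => ?_
    have := hosc r hr0 (hr.2.trans_lt hb1) (u x) (hu x hx) (hur x)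
    calc a x * G (u x) - a x * G r ≤ |a x * G (u x) - a x * G r| := le_abs_self _
      _ = |a x| * |G (u x) - G r| := by rw [← mul_sub, abs_mul]
      _ ≤ |a x| * (-I / (2 * A) * G r) := by gcongr
      _ = _ := mul_comm _ _
  rw [intervalIntegral.integral_sub (hia _ _) ((ha _ _).mul_const _),
    intervalIntegral.integral_mul_const, hper.intervalIntegral_add_eq t₀ 0,
    hap.intervalIntegral_add_eq t₀ 0, zero_add] at hdiff
  have h5 : -I / (2 * A) * G r * A = -I * G r / 2 := by field_simp
  have h6 : I * G r < 0 := mul_neg_of_neg_of_pos haneg hGr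
  have h7 : ∫ x in (0 : ℝ)..T, a x * G (u x) < 0 := by
    simp only [I] at h5 h6 hdiff ⊢
    linarith
  have h8 : 0 < β * P := by
    rw [H.forcing_mul_eq ha hG]; nlinarith
  exact pos_of_mul_pos_left h8 hapos.le

end IsForcedSol

/-- The integrals of an almost everywhere positive function over subintervals of fixed length are
bounded away from zero. -/
theorem exists_pos_forall_le_integral {a : ℝ → ℝ}
    (ha : ∀ s t, IntervalIntegrable a volume s t) {σ τ δ : ℝ} (hδ : 0 < δ)
    (hpos : ∀ᵐ t, t ∈ Icc σ τ → 0 < a t) :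
    ∃ α > 0, ∀ t, σ ≤ t → t + δ ≤ τ → α ≤ ∫ x in t..t + δ, a x := by
  rcases lt_or_ge (τ - δ) σ with hlt | hle
  · exact ⟨1, one_pos, fun t h1 h2 => absurd h2 (by linarith)⟩
  have hcont : Continuous fun t => ∫ x in t..t + δ, a x := by
    have h1 : (fun t => ∫ x in t..t + δ, a x)
        = fun t => (∫ x in (0 : ℝ)..t + δ, a x) - ∫ x in (0 : ℝ)..t, a x := by
      ext t
      rw [intervalIntegral.integral_interval_sub_left (ha _ _) (ha _ _)]
    have h2 := intervalIntegral.continuous_primitive ha 0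
    rw [h1]
    exact (h2.comp (continuous_id.add continuous_const)).sub h2
  obtain ⟨t₀, ht₀, hmin⟩ := (isCompact_Icc (a := σ) (b := τ - δ)).exists_isMinOn
    (nonempty_Icc.2 hle) hcont.continuousOn
  refine ⟨∫ x in t₀..t₀ + δ, a x, ?_, fun t h1 h2 => hmin ⟨h1, by linarith⟩⟩
  have hae : ∀ᵐ x ∂volume.restrict (Ioc t₀ (t₀ + δ)), 0 < a x := by
    rw [ae_restrict_iff' measurableSet_Ioc]
    filter_upwards [hpos] with x hx hxt
    exact hx ⟨ht₀.1.trans hxt.1.le, hxt.2.trans (by linarith [ht₀.2])⟩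
  have hle' : t₀ ≤ t₀ + δ := by linarith
  rw [gt_iff_lt, intervalIntegral.integral_of_le hle',
    integral_pos_iff_support_of_nonneg_ae (hae.mono fun x hx => hx.le) (ha _ _).1]
  have h3 : volume.restrict (Ioc t₀ (t₀ + δ)) (Function.support a)
      = volume.restrict (Ioc t₀ (t₀ + δ)) univ :=
    measure_congr (eventuallyEq_set.2 (hae.mono fun x hx => by simp [hx.ne']))
  rw [h3, Measure.restrict_apply_univ, Real.volume_Ioc]
  simpa using hδ

namespace IsForcedSol

variable {T lam β : ℝ} {h : ℝ → ℝ → ℝ} {a G u v : ℝ → ℝ}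

theorem snd_le_of_ae_nonneg (H : IsForcedSol T lam β h a G u v) (hlam : 0 ≤ lam) (hβ : 0 ≤ β)
    (hGnn : ∀ x, 0 ≤ G x) {s t : ℝ} (hst : s ≤ t) (ha0 : ∀ᵐ x, x ∈ Icc s t → 0 ≤ a x) :
    v t ≤ v s := by
  have h1 : 0 ≤ ∫ x in s..t, (lam * (a x * G (u x)) + β * max (a x) 0) := by
    refine intervalIntegral.integral_nonneg_of_ae_restrict hst ?_
    rw [EventuallyLE, ae_restrict_iff' measurableSet_Icc]
    filter_upwards [ha0] with x hx hxs
    have := hx hxs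
    have := hGnn (u x)
    simp only [Pi.zero_apply]
    positivity
  have h2 := H.snd_sub s t
  rw [intervalIntegral.integral_neg] at h2
  linarith

theorem snd_le_of_ae_nonpos (H : IsForcedSol T lam β h a G u v) (hlam : 0 ≤ lam)
    (hGnn : ∀ x, 0 ≤ G x) {s t : ℝ} (hst : s ≤ t) (ha0 : ∀ᵐ x, x ∈ Ioc s t → a x ≤ 0) :
    v s ≤ v t := by
  have h1 : 0 ≤ ∫ x in s..t, -(lam * (a x * G (u x)) + β * max (a x) 0) := by
    rw [intervalIntegral.integral_of_le hst]
    refine setIntegral_nonneg_of_ae_restrict ?_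
    rw [EventuallyLE, ae_restrict_iff' measurableSet_Ioc]
    filter_upwards [ha0] with x hx hxs
    have h1 := hx hxs
    rw [max_eq_right h1]
    have h2 := mul_nonneg hlam (mul_nonneg (neg_nonneg.2 h1) (hGnn (u x)))
    simp only [Pi.zero_apply]
    linarith
  have h2 := H.snd_sub s t
  linarith

/-- If `a` is positive enough to the right of a maximum point of `u`, the solution must leave the
half-plane `u ≥ 0`. -/
theorem not_max_of_large (H : IsForcedSol T lam β h a G u v)
    (hhc : Continuous (Function.uncurry h)) (hh1 : ∀ t, StrictMono (h t))
    (ha : ∀ s t, IntervalIntegrable a volume s t) (hG : Continuous G) (hGnn : ∀ x, 0 ≤ G x)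
    (hlam : 0 ≤ lam) (hβ : 0 ≤ β) (hu0 : ∀ t, 0 ≤ u t)
    {R κ η C δ γ α t₀ : ℝ} (hR : 0 < R) (hκ : 0 < κ) (hηκ : η * κ = 2 * R)
    (hη : ∀ t, h t (-1) ≤ -η) (hC0 : 0 ≤ C) (hC : ∀ t, -C ≤ h t (-1)) (hδ : 0 < δ) (hδκ : δ ≤ κ)
    (hCδ : C * δ ≤ R / 2) (hγ : ∀ x ∈ Icc (R / 2) R, γ ≤ G x) (hγ0 : 0 ≤ γ)
    (hα : α ≤ ∫ x in t₀..t₀ + δ, a x) (hlarge : 1 < lam * (γ * α))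
    (ha0 : ∀ᵐ x, x ∈ Icc t₀ (t₀ + 2 * κ) → 0 ≤ a x) (hv₀ : v t₀ = 0) (hut₀ : u t₀ = R)
    (huR : ∀ t, u t ≤ R) : False := by
  have hanti : ∀ s t, t₀ ≤ s → s ≤ t → t ≤ t₀ + 2 * κ → v t ≤ v s := fun s t h1 h2 h3 =>
    H.snd_le_of_ae_nonneg hlam hβ hGnn h2
      (ha0.mono fun x hx hxs => hx ⟨h1.trans hxs.1, hxs.2.trans h3⟩)
  rcases le_or_gt (v (t₀ + κ)) (-1) with hv | hv
  · have h1 : u (t₀ + 2 * κ) - u (t₀ + κ) ≤ ∫ _x in (t₀ + κ)..(t₀ + 2 * κ), -η := by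
      rw [H.fst_sub]
      refine intervalIntegral.integral_mono_on (by linarith) (H.intervalIntegrable_fst hhc _ _)
        intervalIntegrable_const fun x hx => ?_
      exact ((hh1 x).monotone ((hanti _ _ (by linarith) hx.1 hx.2).trans hv)).trans (hη x)
    rw [intervalIntegral.integral_const, smul_eq_mul] at h1
    have := huR (t₀ + κ)
    have := hu0 (t₀ + 2 * κ)
    nlinarith
  · have hu : ∀ t ∈ Icc t₀ (t₀ + δ), R / 2 ≤ u t := fun t ht => by
      have h1 : ∫ _x in t₀..t, -C ≤ u t - u t₀ := by
        rw [H.fst_sub]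
        refine intervalIntegral.integral_mono_on ht.1 intervalIntegrable_const
          (H.intervalIntegrable_fst hhc _ _) fun x hx => (hC x).trans ((hh1 x).monotone ?_)
        exact hv.le.trans (hanti _ _ hx.1 (by linarith [hx.2, ht.2]) (by linarith))
      rw [intervalIntegral.integral_const, smul_eq_mul] at h1
      have : (t - t₀) * C ≤ δ * C := by
        have : t - t₀ ≤ δ := by linarith [ht.2]
        gcongr
      linarith
    have h1 : v (t₀ + δ) - v t₀ ≤ ∫ x in t₀..t₀ + δ, -(lam * (γ * a x)) := by
      rw [H.snd_sub]
      refine intervalIntegral.integral_mono_ae_restrict (by linarith)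
        (H.intervalIntegrable_snd ha hG _ _) (((ha _ _).const_mul _).const_mul _).neg ?_
      rw [EventuallyLE, ae_restrict_iff' measurableSet_Icc]
      filter_upwards [ha0] with x hx hxs
      have h2 := hx ⟨hxs.1, hxs.2.trans (by linarith)⟩
      have h3 := hγ (u x) ⟨hu x hxs, huR x⟩
      have h4 : 0 ≤ β * max (a x) 0 := by positivity
      have h5 : lam * (γ * a x) ≤ lam * (a x * G (u x)) := by
        rw [mul_comm γ]; gcongr
      linarith
    rw [intervalIntegral.integral_neg, intervalIntegral.integral_const_mul,
      intervalIntegral.integral_const_mul, hv₀, sub_zero] at h1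
    have h2 : lam * (γ * α) ≤ lam * (γ * ∫ x in t₀..t₀ + δ, a x) := by gcongr
    have := hanti (t₀ + δ) (t₀ + κ) (by linarith) (by linarith) (by linarith)
    linarith

/-- The maximum is also attained at a point where `a` is positive. -/
theorem exists_max_mem_Icc (H : IsForcedSol T lam β h a G u v) (hT : 0 < T)
    (hhc : Continuous (Function.uncurry h)) (hh0 : ∀ t, h t 0 = 0) (hh1 : ∀ t, StrictMono (h t))
    (hGnn : ∀ x, 0 ≤ G x) (hlam : 0 ≤ lam) {N : ℕ} {σ τ : Fin (N + 1) → ℝ}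
    (hstar : SignChanging T a N σ τ) {R tm : ℝ} (huR : ∀ t, u t ≤ R) (htm : u tm = R) :
    ∃ n, ∃ t ∈ Icc (σ n) (τ n), u t = R := by
  obtain ⟨hστ, hdisj, -, -, hneg⟩ := hstar
  obtain ⟨p, hp, hpu⟩ := H.periodic_fst.exists_mem_Ico hT tm (σ 0)
  rw [htm] at hpu
  by_cases hex : ∃ n, p ∈ Icc (σ n) (τ n)
  · obtain ⟨n, hn⟩ := hex
    exact ⟨n, p, hn, hpu.symm⟩
  push Not at hex
  have hτ0 : τ 0 < p := by
    by_contra! h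
    exact hex 0 ⟨hp.1, h⟩
  obtain ⟨n, hn, hnmax⟩ := (Set.toFinite {n | τ n < p}).exists_maximal ⟨0, hτ0⟩
  have hσ : ∀ m, σ 0 ≤ σ m := fun m => by
    rcases (Fin.zero_le m).eq_or_lt with e | e
    · rw [e]
    · exact ((hστ 0).trans (hdisj 0 m e)).le
  have ha0 : ∀ᵐ x, x ∈ Ioc (τ n) p → a x ≤ 0 := by
    filter_upwards [hneg] with x hx hxp
    refine hx ⟨⟨((hσ n).trans (hστ n).le).trans hxp.1.le, hxp.2.trans_lt hp.2⟩, ?_⟩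
    simp only [mem_iUnion, not_exists]
    intro m hm
    rcases le_or_gt m n with hmn | hmn
    · have : τ m ≤ τ n := by
        rcases hmn.eq_or_lt with e | e
        · rw [e]
        · exact ((hdisj m n e).trans (hστ n)).le
      linarith [hm.2, hxp.1]
    · have h1 : p ≤ τ m := by
        by_contra! h
        exact absurd (hnmax h hmn.le) (not_le.2 hmn)
      exact hex m ⟨hm.1.trans hxp.2, h1⟩
  have hvp : v p = 0 := H.snd_eq_zero_of_isLocalExtr hhc hh0 hh1
    (Or.inr (Eventually.of_forall fun x => (huR x).trans_eq hpu))
  refine ⟨n, τ n, right_mem_Icc.2 (hστ n).le, le_antisymm (huR _) ?_⟩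
  rw [hpu]
  refine H.fst_le_of_snd_nonpos hh0 hh1 hn.le fun x hx => ?_
  rw [← hvp]
  exact H.snd_le_of_ae_nonpos hlam hGnn hx.2
    (ha0.mono fun y hy hyx => hy ⟨hx.1.trans_lt hyx.1, hyx.2⟩)

/-- Large norm: for large `λ` the maximum of a solution with nonnegative forcing cannot equal `R`. -/
theorem exists_large (hT : 0 < T)
    (hhc : Continuous (Function.uncurry h)) (hhper : ∀ t s, h (t + T) s = h t s)
    (hh0 : ∀ t, h t 0 = 0) (hh1 : ∀ t, StrictMono (h t))
    (ha : ∀ s t, IntervalIntegrable a volume s t) {N : ℕ} {σ τ : Fin (N + 1) → ℝ}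
    (hstar : SignChanging T a N σ τ)
    (hG : Continuous G) (hG0 : ∀ x ≤ 0, G x = 0) (hGpos : ∀ x, 0 < x → 0 < G x) :
    ∃ R > 0, ∃ lam₀ > 0, ∀ lam, lam₀ < lam → ∀ β, 0 ≤ β → ∀ u v,
      IsForcedSol T lam β h a G u v → (∀ t, u t ≤ R) → (∃ t, u t = R) → False := by
  have hGnn : ∀ x, 0 ≤ G x := fun x => by
    rcases le_or_gt x 0 with e | e
    · rw [hG0 x e]
    · exact (hGpos x e).le
  have hbound : ∀ s, ∃ t₀, ∀ t, h t s ≤ h t₀ s := fun s =>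
    Function.Periodic.exists_forall_le (f := fun t => h t s) (fun t => hhper t s) hT
      (hhc.comp (continuous_id.prodMk continuous_const))
  have hbound' : ∀ s, ∃ t₀, ∀ t, h t₀ s ≤ h t s := fun s => by
    obtain ⟨t₀, h₀⟩ := Function.Periodic.exists_forall_le (f := fun t => -h t s) (T := T)
      (fun t => by simp only [hhper t s]) hT
      (hhc.comp (continuous_id.prodMk continuous_const)).neg
    exact ⟨t₀, fun t => neg_le_neg_iff.1 (h₀ t)⟩
  obtain ⟨p₁, hp₁⟩ := hbound 1
  obtain ⟨p₂, hp₂⟩ := hbound (-1)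
  obtain ⟨p₃, hp₃⟩ := hbound' 1
  obtain ⟨p₄, hp₄⟩ := hbound' (-1)
  have hpos1 : ∀ t, 0 < h t 1 := fun t => by rw [← hh0 t]; exact hh1 t one_pos
  have hneg1 : ∀ t, h t (-1) < 0 := fun t => by
    conv_rhs => rw [← hh0 t]
    exact hh1 t (by norm_num)
  obtain ⟨κ, hκ, hκle⟩ : ∃ κ > 0, ∀ n, 4 * κ ≤ τ n - σ n := by
    obtain ⟨n, hn⟩ := Finite.exists_min fun n => τ n - σ n
    have := hstar.1 n
    exact ⟨(τ n - σ n) / 4, by linarith, fun m => by linarith [hn m]⟩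
  obtain ⟨η, hη0, hη1, hη2⟩ : ∃ η > 0, (∀ t, η ≤ h t 1) ∧ ∀ t, h t (-1) ≤ -η :=
    ⟨min (h p₃ 1) (-h p₂ (-1)), lt_min (hpos1 _) (neg_pos.2 (hneg1 _)),
      fun t => (min_le_left _ _).trans (hp₃ t),
      fun t => by linarith [hp₂ t, min_le_right (h p₃ 1) (-h p₂ (-1))]⟩
  obtain ⟨C, hC0, hC1, hC2⟩ : ∃ C > 0, (∀ t, h t 1 ≤ C) ∧ ∀ t, -C ≤ h t (-1) :=
    ⟨max (h p₁ 1) (-h p₄ (-1)), lt_max_of_lt_left (hpos1 _),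
      fun t => (hp₁ t).trans (le_max_left _ _),
      fun t => by linarith [hp₄ t, le_max_right (h p₁ 1) (-h p₄ (-1))]⟩
  obtain ⟨R, hR, hηκ⟩ : ∃ R > 0, η * κ = 2 * R := ⟨η * κ / 2, by positivity, by ring⟩
  obtain ⟨δ, hδ, hδκ, hCδ⟩ : ∃ δ > 0, δ ≤ κ ∧ C * δ ≤ R / 2 :=
    ⟨min κ (R / (2 * C)), by positivity, min_le_left _ _, by
      calc C * min κ (R / (2 * C)) ≤ C * (R / (2 * C)) := by gcongr; exact min_le_right _ _
        _ = R / 2 := by field_simp⟩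
  obtain ⟨γ, hγ0, hγ⟩ : ∃ γ > 0, ∀ x ∈ Icc (R / 2) R, γ ≤ G x := by
    obtain ⟨x, hx, hmin⟩ := (isCompact_Icc (a := R / 2) (b := R)).exists_isMinOn
      (nonempty_Icc.2 (by linarith)) hG.continuousOn
    exact ⟨G x, hGpos x (by linarith [hx.1]), fun y hy => hmin hy⟩
  obtain ⟨α, hα0, hα⟩ : ∃ α > 0, ∀ n t, σ n ≤ t → t + δ ≤ τ n → α ≤ ∫ x in t..t + δ, a x := by
    choose α hα0 hα using fun n => exists_pos_forall_le_integral ha hδ (hstar.2.2.2.1 n)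
    obtain ⟨n, hn⟩ := Finite.exists_min α
    exact ⟨α n, hα0 n, fun m t h1 h2 => (hn m).trans (hα m t h1 h2)⟩
  refine ⟨R, hR, 1 / (γ * α), by positivity, fun lam hlam β hβ u v H huR ⟨tm, htm⟩ => ?_⟩
  have hlam0 : 0 < lam := lt_trans (by positivity) hlam
  have hlarge : 1 < lam * (γ * α) := (div_lt_iff₀ (by positivity)).1 hlam
  have hu0 := H.fst_nonneg hT hhc hh0 hh1 hG0 hβ (tp := tm) (by rw [htm]; exact hR)
  obtain ⟨n, t₀, ht₀, hut₀⟩ := H.exists_max_mem_Icc hT hhc hh0 hh1 hGnn hlam0.le hstar huR htm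
  have hv₀ : v t₀ = 0 := H.snd_eq_zero_of_isLocalExtr hhc hh0 hh1
    (Or.inr (Eventually.of_forall fun x => (huR x).trans_eq hut₀.symm))
  have hapos := hstar.2.2.2.1 n
  have hκn := hκle n
  rcases le_or_gt (t₀ + 2 * κ) (τ n) with hr | hl
  · exact H.not_max_of_large hhc hh1 ha hG hGnn hlam0.le hβ hu0 hR hκ hηκ hη2 hC0.le hC2 hδ hδκ
      hCδ hγ hγ0.le (hα n t₀ ht₀.1 (by linarith)) hlarge
      (hapos.mono fun x hx hxt => (hx ⟨ht₀.1.trans hxt.1, hxt.2.trans hr⟩).le) hv₀ hut₀ huR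
  · refine H.reverse.not_max_of_large (t₀ := -t₀) (η := η) (C := C) (δ := δ) (γ := γ) (α := α)
      (κ := κ) (R := R) ?_ ?_ ?_ hG hGnn hlam0.le hβ (fun t => hu0 _) hR hκ hηκ ?_ hC0.le ?_ hδ
      hδκ hCδ hγ hγ0.le ?_ hlarge ?_ ?_ ?_ fun t => huR _
    · exact (hhc.comp (_root_.continuous_fst.neg.prodMk _root_.continuous_snd.neg)).neg
    · exact fun t x y hxy => neg_lt_neg (hh1 _ (neg_lt_neg hxy))
    · intro s t
      simpa using (IntervalIntegrable.iff_comp_neg).1 (ha (-s) (-t))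
    · exact fun t => by simpa using hη1 (-t)
    · exact fun t => by simpa using hC1 (-t)
    · rw [intervalIntegral.integral_comp_neg]
      have := hα n (t₀ - δ) (by linarith) (by linarith [ht₀.2])
      convert this using 2 <;> ring
    · have := (Measure.measurePreserving_neg (volume : Measure ℝ)).quasiMeasurePreserving.ae hapos
      filter_upwards [this] with x hx hxt
      exact (hx ⟨by linarith [hxt.2], by linarith [hxt.1, ht₀.2]⟩).le
    · simp [hv₀]
    · simpa using hut₀

end IsForcedSol

/-- The continuous functions on `[0, T]` vanishing at `0` with a given Lipschitz constant form a
compact set. -/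
theorem isCompact_setOf_lipschitz {T : ℝ} (hT : 0 ≤ T) {C : ℝ} (hC : 0 ≤ C) :
    IsCompact {w : C(Icc 0 T, ℝ) | w ⟨0, left_mem_Icc.2 hT⟩ = 0 ∧
      ∀ x y : Icc 0 T, |w x - w y| ≤ C * |(x : ℝ) - y|} := by
  set z : Icc 0 T := ⟨0, left_mem_Icc.2 hT⟩
  have hlip : ∀ w : Icc 0 T → ℝ, (∀ x y : Icc 0 T, |w x - w y| ≤ C * |(x : ℝ) - y|) →
      LipschitzWith C.toNNReal w := fun w hw => by
    refine LipschitzWith.of_dist_le_mul fun x y => ?_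
    rw [Real.coe_toNNReal C hC]
    exact hw x y
  refine ArzelaAscoli.isCompact_of_equicontinuous _ ?_ ?_
  · have himage : ContinuousMap.toFun '' {w : C(Icc 0 T, ℝ) | w z = 0 ∧
        ∀ x y : Icc 0 T, |w x - w y| ≤ C * |(x : ℝ) - y|}
        = {w : Icc 0 T → ℝ | w z = 0 ∧ ∀ x y : Icc 0 T, |w x - w y| ≤ C * |(x : ℝ) - y|} := by
      ext w
      constructor
      · rintro ⟨w, hw, rfl⟩
        exact hw
      · exact fun hw => ⟨⟨w, (hlip w hw.2).continuous⟩, hw, rfl⟩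
    rw [himage]
    refine (isCompact_univ_pi fun _ => isCompact_Icc (a := -(C * T)) (b := C * T)).of_isClosed_subset
      ?_ ?_
    · have h1 : {w : Icc 0 T → ℝ | w z = 0 ∧ ∀ x y : Icc 0 T, |w x - w y| ≤ C * |(x : ℝ) - y|}
          = {w | w z = 0} ∩ ⋂ x : Icc 0 T, ⋂ y : Icc 0 T, {w | |w x - w y| ≤ C * |(x : ℝ) - y|} := by
        ext w; simp only [mem_inter_iff, mem_iInter, mem_ofPred_eq]
      rw [h1]
      exact (isClosed_eq (continuous_apply z) continuous_const).inter
        (isClosed_iInter fun x => isClosed_iInter fun y =>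
          isClosed_le ((continuous_apply x).sub (continuous_apply y)).abs continuous_const)
    · intro w hw x _
      have h1 := hw.2 x z
      rw [hw.1, sub_zero, sub_zero, abs_of_nonneg x.2.1] at h1
      exact abs_le.1 (h1.trans (by gcongr; exact x.2.2))
  · exact (LipschitzWith.uniformEquicontinuous _ C.toNNReal
      fun w => hlip _ w.2.2).equicontinuous

/-- Joint continuity of a primitive with integrable weight. -/
theorem continuous_primitive_mul {X : Type*} [TopologicalSpace X] [FirstCountableTopology X]
    {b : ℝ → ℝ} (hb : ∀ s t, IntervalIntegrable b volume s t) {f : X → ℝ → ℝ}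
    (hf : Continuous (Function.uncurry f)) :
    Continuous fun p : X × ℝ => ∫ x in (0 : ℝ)..p.2, b x * f p.1 x := by
  rw [continuous_iff_continuousAt]
  rintro ⟨x₀, t₀⟩
  have hfx : ∀ x, Continuous (f x) := fun x => hf.comp (continuous_const.prodMk continuous_id)
  set l := min 0 t₀ - 1
  set m := max 0 t₀ + 1
  have hl1 : l < 0 := by linarith [min_le_left 0 t₀]
  have hl2 : l < t₀ := by linarith [min_le_right 0 t₀]
  have hm1 : 0 < m := by linarith [le_max_left 0 t₀]
  have hm2 : t₀ < m := by linarith [le_max_right 0 t₀]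
  obtain ⟨B, hB⟩ := (isCompact_Icc (a := l) (b := m)).exists_bound_of_continuousOn
    (hfx x₀).continuousOn
  have hev : ∀ᶠ x in nhds x₀, ∀ t ∈ Icc l m, |f x t| < B + 1 := by
    refine isCompact_Icc.eventually_forall_of_forall_eventually fun t ht => ?_
    have h1 : |f x₀ t| < B + 1 := (hB t ht).trans_lt (by linarith)
    exact hf.abs.continuousAt.eventually_lt continuousAt_const h1
  refine intervalIntegral.continuousAt_parametric_primitive_of_dominated
    (F := fun x t => b t * f x t) (fun t => |b t| * (B + 1)) l m (fun x => ?_) ?_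
    ((hb _ _).abs.mul_const _) (ae_of_all _ fun t => ?_) ⟨hl1, hm1⟩ ⟨hl2, hm2⟩
    Real.volume_singleton
  · exact ((hb l m).mul_continuousOn (hfx x).continuousOn).def'.aestronglyMeasurable
  · filter_upwards [hev] with x hx
    refine (ae_restrict_iff' measurableSet_uIoc).2 (ae_of_all _ fun t ht => ?_)
    rw [uIoc_of_le (hl1.trans hm1).le] at ht
    rw [norm_mul, Real.norm_eq_abs, Real.norm_eq_abs]
    have := hx t (Ioc_subset_Icc_self ht)
    gcongr
  · exact continuousAt_const.mul
      (hf.comp (continuous_id.prodMk continuous_const)).continuousAt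

/-- A continuous function on `[0, T]` with equal values at the endpoints extends periodically. -/
theorem exists_periodic_extension {T : ℝ} (hT : 0 < T) {f : ℝ → ℝ} (hf : Continuous f)
    (h0 : f 0 = f T) :
    ∃ F : ℝ → ℝ, Continuous F ∧ Function.Periodic F T ∧ EqOn F f (Icc 0 T) := by
  have : Fact (0 < T) := ⟨hT⟩
  have hper : Function.Periodic (fun t : ℝ => AddCircle.liftIco T 0 f (t : AddCircle T)) T :=
    fun t => by simp only [AddCircle.coe_add_period]
  have hIco : ∀ t ∈ Ico 0 T, AddCircle.liftIco T 0 f (t : AddCircle T) = f t :=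
    fun t ht => AddCircle.liftIco_zero_coe_apply ht
  refine ⟨_, (AddCircle.liftIco_zero_continuous h0 hf.continuousOn).comp
    (AddCircle.continuous_mk' T), hper, fun t ht => ?_⟩
  rcases ht.2.eq_or_lt with e | e
  · have h1 := hper 0
    simp only [zero_add] at h1
    change AddCircle.liftIco T 0 f (t : AddCircle T) = f t
    rw [e, h1, hIco 0 ⟨le_rfl, hT⟩, h0]
  · exact hIco t ⟨ht.1, e⟩

/-- An integral identity on one period extends to the whole line. -/
theorem Function.Periodic.sub_eq_integral {T : ℝ} (hT : 0 < T) {F k : ℝ → ℝ}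
    (hF : Function.Periodic F T) (hk : Function.Periodic k T)
    (hki : ∀ s t, IntervalIntegrable k volume s t)
    (hFk : ∀ t ∈ Icc 0 T, F t - F 0 = ∫ x in (0 : ℝ)..t, k x) (s t : ℝ) :
    F t - F s = ∫ x in s..t, k x := by
  have hT0 : ∫ x in (0 : ℝ)..T, k x = 0 := by
    have h1 := hF 0
    rw [zero_add] at h1
    rw [← hFk T (right_mem_Icc.2 hT.le), h1, sub_self]
  have hper : Function.Periodic (fun t => F t - F 0 - ∫ x in (0 : ℝ)..t, k x) T := fun t => by
    have h1 := intervalIntegral.integral_add_adjacent_intervals (hki 0 t) (hki t (t + T))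
    rw [hk.intervalIntegral_add_eq t 0, zero_add, hT0, add_zero] at h1
    simp only [hF t, h1]
  have hall : ∀ t, F t - F 0 = ∫ x in (0 : ℝ)..t, k x := fun t => by
    obtain ⟨y, hy, hyt⟩ := hper.exists_mem_Ico₀ hT t
    simp only [hFk y (Ico_subset_Icc_self hy), sub_self] at hyt
    linarith
  have h2 := intervalIntegral.integral_interval_sub_left (hki 0 t) (hki 0 s)
  rw [← hall, ← hall] at h2
  linarith

/-- Schauder's theorem applied to the truncated problem: the maximum `M` of `u` and the initial
value `c` of `v` are corrected by the forcing `β` and by the increment of `u`, respectively. -/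
theorem exists_truncated_sol {T lam r R L γ : ℝ} (hT : 0 < T) {h : ℝ → ℝ → ℝ}
    (hhc : Continuous (Function.uncurry h)) {a G : ℝ → ℝ}
    (ha : ∀ s t, IntervalIntegrable a volume s t)
    (hapos : 0 < ∫ x in (0 : ℝ)..T, max (a x) 0)
    (hlam : 0 ≤ lam) (hG : Continuous G) (hGγ : ∀ x ≤ R, |G x| ≤ γ) (hrR : r ≤ R)
    (hL : 2 * (lam * (γ * ∫ x in (0 : ℝ)..T, |a x|)) = L) :
    ∃ M ∈ Icc r R, ∃ c ∈ Icc (-L) L, ∃ β : ℝ, ∃ u v : ℝ → ℝ, Continuous u ∧ Continuous v ∧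
      (∀ t, u t ≤ M) ∧ (∃ t ∈ Icc 0 T, u t = M) ∧ (∀ t ∈ Icc 0 T, |v t - c| ≤ L) ∧
      (∀ t ∈ Icc 0 T, u t - u 0 = ∫ x in (0 : ℝ)..t, h x (v x)) ∧
      (∀ t, v t - v 0 = ∫ x in (0 : ℝ)..t, -(lam * (a x * G (u x)) + β * max (a x) 0)) ∧
      v T = v 0 ∧ M = max r (min R (M + β)) ∧
      c = max (-L) (min L (c - ∫ x in (0 : ℝ)..T, h x (v x))) := by
  have hp : ∀ s t, IntervalIntegrable (fun x => max (a x) 0) volume s t := fun s t =>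
    ⟨(ha s t).1.pos_part, (ha s t).2.pos_part⟩
  have hne : (Icc 0 T).Nonempty := nonempty_Icc.2 hT.le
  have hneI : Nonempty (Icc 0 T) := hne.to_subtype
  set P := ∫ x in (0 : ℝ)..T, max (a x) 0
  set A := ∫ x in (0 : ℝ)..T, |a x|
  have hA : 0 ≤ A := intervalIntegral.integral_nonneg hT.le fun x _ => abs_nonneg _
  have hγ : 0 ≤ γ := (abs_nonneg _).trans (hGγ R le_rfl)
  have hL0 : 0 ≤ L := by rw [← hL]; positivity
  let mx : C(Icc 0 T, ℝ) → ℝ := fun w => sSup ((fun x => w x) '' univ)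
  have hmxc : Continuous mx := isCompact_univ.continuous_sSup
    (f := fun (w : C(Icc 0 T, ℝ)) x => w x) continuous_eval
  have hmx_le : ∀ w x, w x ≤ mx w := fun w x =>
    le_csSup (isCompact_univ.image w.continuous).bddAbove ⟨x, trivial, rfl⟩
  have hmx_eq : ∀ w : C(Icc 0 T, ℝ), ∃ x, w x = mx w := fun w => by
    obtain ⟨x, -, hx⟩ := (isCompact_univ.image w.continuous).sSup_mem (univ_nonempty.image _)
    exact ⟨x, hx⟩
  let U : ℝ × ℝ × C(Icc 0 T, ℝ) → ℝ → ℝ := fun p t =>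
    p.1 + p.2.2 (projIcc 0 T hT.le t) - mx p.2.2
  have hUc : Continuous (Function.uncurry U) := by
    have h1 : Continuous fun q : (ℝ × ℝ × C(Icc 0 T, ℝ)) × ℝ =>
        q.1.2.2 (projIcc 0 T hT.le q.2) := by
      exact (continuous_snd.comp (continuous_snd.comp continuous_fst)).eval
        (continuous_projIcc.comp continuous_snd)
    exact ((continuous_fst.comp continuous_fst).add h1).sub
      (hmxc.comp (continuous_snd.comp (continuous_snd.comp continuous_fst)))
  have hU_le : ∀ p t, U p t ≤ p.1 := fun p t => by
    have := hmx_le p.2.2 (projIcc 0 T hT.le t)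
    simp only [U]; linarith
  let S : ℝ × ℝ × C(Icc 0 T, ℝ) → ℝ → ℝ := fun p t => ∫ x in (0 : ℝ)..t, a x * G (U p x)
  have hSc : Continuous (Function.uncurry S) :=
    continuous_primitive_mul ha (f := fun p x => G (U p x)) (hG.comp hUc)
  let B : ℝ × ℝ × C(Icc 0 T, ℝ) → ℝ := fun p => -(lam * S p T) / P
  have hBc : Continuous B :=
    ((hSc.comp (continuous_id.prodMk continuous_const)).const_mul lam).neg.div_const P
  let V : ℝ × ℝ × C(Icc 0 T, ℝ) → ℝ → ℝ := fun p t =>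
    p.2.1 - (lam * S p t + B p * ∫ x in (0 : ℝ)..t, max (a x) 0)
  have hVc : Continuous (Function.uncurry V) :=
    (continuous_fst.comp (continuous_snd.comp continuous_fst)).sub
      ((hSc.const_mul lam).add ((hBc.comp continuous_fst).mul
        ((intervalIntegral.continuous_primitive hp 0).comp continuous_snd)))
  let W : ℝ × ℝ × C(Icc 0 T, ℝ) → ℝ → ℝ := fun p t => ∫ x in (0 : ℝ)..t, h x (V p x)
  have hWc : Continuous (Function.uncurry W) := by
    have h1 : Continuous (Function.uncurry fun p x => h x (V p x)) :=
      hhc.comp (continuous_snd.prodMk hVc)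
    have h2 := continuous_primitive_mul (b := fun _ => 1) (fun _ _ => intervalIntegrable_const) h1
    simp only [one_mul] at h2
    exact h2
  have hUp : ∀ p, Continuous (U p) := fun p => hUc.comp (continuous_const.prodMk continuous_id)
  have hVp : ∀ p, Continuous (V p) := fun p => hVc.comp (continuous_const.prodMk continuous_id)
  have hWp : ∀ p, Continuous (W p) := fun p => hWc.comp (continuous_const.prodMk continuous_id)
  have hhV : ∀ p s t, IntervalIntegrable (fun x => h x (V p x)) volume s t := fun p s t =>
    (hhc.comp (continuous_id.prodMk (hVp p))).intervalIntegrable s t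
  have hS_le : ∀ p, p.1 ≤ R → ∀ t ∈ Icc 0 T, |S p t| ≤ γ * A := fun p hpR t ht => by
    calc |S p t| ≤ ∫ x in (0 : ℝ)..t, γ * |a x| := by
          rw [← Real.norm_eq_abs]
          refine intervalIntegral.norm_integral_le_of_norm_le ht.1 (ae_of_all _ fun x _ => ?_)
            ((ha _ _).abs.const_mul _)
          rw [Real.norm_eq_abs, abs_mul, mul_comm]
          have := hGγ (U p x) ((hU_le p x).trans hpR)
          gcongr
      _ ≤ ∫ x in (0 : ℝ)..T, γ * |a x| :=
          intervalIntegral.integral_mono_interval le_rfl ht.1 ht.2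
            (ae_of_all _ fun x => by positivity) ((ha _ _).abs.const_mul _)
      _ = γ * A := intervalIntegral.integral_const_mul _ _
  have hV_le : ∀ p, p.1 ≤ R → ∀ t ∈ Icc 0 T, |V p t - p.2.1| ≤ L := fun p hpR t ht => by
    have h1 := hS_le p hpR t ht
    have h2 := hS_le p hpR T (right_mem_Icc.2 hT.le)
    have h3 : 0 ≤ ∫ x in (0 : ℝ)..t, max (a x) 0 :=
      intervalIntegral.integral_nonneg ht.1 fun x _ => le_max_right _ _
    have h4 : ∫ x in (0 : ℝ)..t, max (a x) 0 ≤ P :=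
      intervalIntegral.integral_mono_interval le_rfl ht.1 ht.2
        (ae_of_all _ fun x => le_max_right _ _) (hp _ _)
    have h5 : |B p| * P = lam * |S p T| := by
      simp only [B, abs_div, abs_neg, abs_mul, abs_of_nonneg hlam, abs_of_pos hapos]
      field_simp
    calc |V p t - p.2.1| = |lam * S p t + B p * ∫ x in (0 : ℝ)..t, max (a x) 0| := by
          simp only [V]; rw [sub_sub_cancel_left, abs_neg]
      _ ≤ lam * |S p t| + |B p| * ∫ x in (0 : ℝ)..t, max (a x) 0 := by
          refine (abs_add_le _ _).trans_eq ?_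
          rw [abs_mul, abs_mul, abs_of_nonneg hlam, abs_of_nonneg h3]
      _ ≤ lam * (γ * A) + |B p| * P := by gcongr
      _ ≤ lam * (γ * A) + lam * (γ * A) := by rw [h5]; gcongr
      _ = L := by rw [← hL]; ring
  obtain ⟨C, hC⟩ := ((isCompact_Icc (a := 0) (b := T)).prod
    (isCompact_Icc (a := -(2 * L)) (b := 2 * L))).exists_bound_of_continuousOn hhc.continuousOn
  have hC0 : 0 ≤ C := (norm_nonneg _).trans
    (hC (0, 0) ⟨left_mem_Icc.2 hT.le, by constructor <;> linarith⟩)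
  set z : Icc 0 T := ⟨0, left_mem_Icc.2 hT.le⟩
  set KW := {w : C(Icc 0 T, ℝ) | w z = 0 ∧ ∀ x y : Icc 0 T, |w x - w y| ≤ C * |(x : ℝ) - y|}
  set K := Icc r R ×ˢ (Icc (-L) L ×ˢ KW)
  let Φ : ℝ × ℝ × C(Icc 0 T, ℝ) → ℝ × ℝ × C(Icc 0 T, ℝ) := fun p =>
    (max r (min R (p.1 + B p)), max (-L) (min L (p.2.1 - W p T)),
      ⟨fun x => W p x, (hWp p).comp continuous_subtype_val⟩)
  have hΦc : Continuous Φ := by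
    refine Continuous.prodMk ?_ (Continuous.prodMk ?_ ?_)
    · exact continuous_const.max (continuous_const.min (continuous_fst.add hBc))
    · exact continuous_const.max (continuous_const.min
        ((continuous_fst.comp continuous_snd).sub
          (hWc.comp (continuous_id.prodMk continuous_const))))
    · exact ContinuousMap.continuous_of_continuous_uncurry _
        (hWc.comp (continuous_fst.prodMk (continuous_subtype_val.comp continuous_snd)))
  have hKc : IsCompact K :=
    isCompact_Icc.prod (isCompact_Icc.prod (isCompact_setOf_lipschitz hT.le hC0))
  have hKW : Convex ℝ KW := by
    intro w hw w' hw' b b' hb hb' hbb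
    refine ⟨by simp [hw.1, hw'.1], fun x y => ?_⟩
    calc |(b • w + b' • w') x - (b • w + b' • w') y|
        = |b * (w x - w y) + b' * (w' x - w' y)| := by
          simp only [ContinuousMap.add_apply, ContinuousMap.smul_apply, smul_eq_mul]
          congr 1; ring
      _ ≤ b * |w x - w y| + b' * |w' x - w' y| := by
          refine (abs_add_le _ _).trans_eq ?_
          rw [abs_mul, abs_mul, abs_of_nonneg hb, abs_of_nonneg hb']
      _ ≤ b * (C * |(x : ℝ) - y|) + b' * (C * |(x : ℝ) - y|) := by
          have h1 := hw.2 x y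
          have h2 := hw'.2 x y
          gcongr
      _ = C * |(x : ℝ) - y| := by rw [← add_mul, hbb, one_mul]
  have hKconv : Convex ℝ K := (convex_Icc r R).prod ((convex_Icc (-L) L).prod hKW)
  have hKne : K.Nonempty :=
    ⟨(r, 0, 0), ⟨le_rfl, hrR⟩, ⟨by simpa using hL0, hL0⟩, by simp, fun x y => by
      simp only [ContinuousMap.zero_apply, sub_self, abs_zero]; positivity⟩
  have hmaps : MapsTo Φ K K := by
    rintro p ⟨hp1, hp2, -⟩
    refine ⟨⟨le_max_left _ _, max_le hrR (min_le_left _ _)⟩,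
      ⟨le_max_left _ _, max_le (by linarith) (min_le_left _ _)⟩, ?_, fun x y => ?_⟩
    · exact intervalIntegral.integral_same
    · change |W p x - W p y| ≤ _
      simp only [W]
      rw [intervalIntegral.integral_interval_sub_left (hhV p _ _) (hhV p _ _)]
      refine (Real.norm_eq_abs _).symm.trans_le
        (intervalIntegral.norm_integral_le_of_norm_le_const fun s hs => ?_)
      have hsT : s ∈ Icc 0 T := uIcc_subset_Icc y.2 x.2 (uIoc_subset_uIcc hs)
      have h1 := abs_le.1 (hV_le p hp1.2 s hsT)
      exact hC (s, V p s) ⟨hsT, by constructor <;> linarith [hp2.1, hp2.2]⟩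
  obtain ⟨p, hpK, hfix⟩ := exists_fixedPoint_of_isCompact_of_convex hKc hKconv hKne
    hΦc.continuousOn hmaps
  have hfix1 : max r (min R (p.1 + B p)) = p.1 := congrArg Prod.fst hfix
  have hfix2 : max (-L) (min L (p.2.1 - W p T)) = p.2.1 := congrArg (fun q => q.2.1) hfix
  have hfix3 : ∀ x : Icc 0 T, W p x = p.2.2 x := fun x =>
    congrArg (fun q : ℝ × ℝ × C(Icc 0 T, ℝ) => q.2.2 x) hfix
  have hV0 : V p 0 = p.2.1 := by simp [V, S]
  refine ⟨p.1, hpK.1, p.2.1, hpK.2.1, B p, U p, V p, hUp p, hVp p, hU_le p, ?_,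
    hV_le p hpK.1.2, fun t ht => ?_, fun t => ?_, ?_, hfix1.symm, hfix2.symm⟩
  · obtain ⟨x, hx⟩ := hmx_eq p.2.2
    exact ⟨x, x.2, by simp only [U, projIcc_val, hx]; ring⟩
  · have h1 := hfix3 ⟨t, ht⟩
    have h2 : p.2.2 z = 0 := hpK.2.2.1
    have h3 : projIcc 0 T hT.le 0 = z := projIcc_left hT.le
    simp only [U, projIcc_of_mem hT.le ht, h3, h2, ← h1, W]
    ring
  · have h1 : IntervalIntegrable (fun x => a x * G (U p x)) volume 0 t :=
      (ha 0 t).mul_continuousOn (hG.comp (hUp p)).continuousOn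
    rw [hV0, intervalIntegral.integral_neg, intervalIntegral.integral_add (h1.const_mul lam)
      ((hp 0 t).const_mul _), intervalIntegral.integral_const_mul,
      intervalIntegral.integral_const_mul]
    simp only [V, S]
    ring
  · rw [hV0]
    have h1 : B p * P = -(lam * S p T) := div_mul_cancel₀ _ hapos.ne'
    have h2 : V p T = p.2.1 - (lam * S p T + B p * P) := rfl
    rw [h2, h1]
    ring

/-- Existence of an unforced periodic solution whose maximum lies between the two levels at which
forcing is, respectively, necessarily positive and necessarily negative. -/
theorem exists_isForcedSol_zero {T lam r R : ℝ} (hT : 0 < T) {h : ℝ → ℝ → ℝ}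
    (hhc : Continuous (Function.uncurry h)) (hhper : ∀ t s, h (t + T) s = h t s)
    (hh0 : ∀ t, h t 0 = 0) (hh1 : ∀ t, StrictMono (h t)) {a G : ℝ → ℝ}
    (ha : ∀ s t, IntervalIntegrable a volume s t) (hap : Function.Periodic a T)
    (hapos : 0 < ∫ x in (0 : ℝ)..T, max (a x) 0)
    (hlam : 0 ≤ lam) (hG : Continuous G) (hG0 : ∀ x ≤ 0, G x = 0) (hr : 0 < r) (hrR : r < R)
    (hsmall : ∀ β u v, IsForcedSol T lam β h a G u v → (∀ t, u t ≤ r) → (∃ t, u t = r) → 0 < β)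
    (hlarge : ∀ β, 0 ≤ β → ∀ u v, IsForcedSol T lam β h a G u v → (∀ t, u t ≤ R) →
      (∃ t, u t = R) → False) :
    ∃ u v, IsForcedSol T lam 0 h a G u v ∧ ∃ t, 0 < u t := by
  obtain ⟨γ, hγ⟩ := (isCompact_Icc (a := 0) (b := R)).exists_bound_of_continuousOn hG.continuousOn
  have hGγ : ∀ x ≤ R, |G x| ≤ γ := fun x hx => by
    rcases le_or_gt x 0 with e | e
    · rw [hG0 x e, abs_zero]
      exact (norm_nonneg _).trans (hγ R (right_mem_Icc.2 (hr.trans hrR).le))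
    · exact hγ x ⟨e.le, hx⟩
  obtain ⟨M, hM, c, hc, β, u, v, huc, hvc, huM, ⟨tm, htm, hutm⟩, hvL, hu, hv, hvT, hMeq, hceq⟩ :=
    exists_truncated_sol hT hhc ha hapos hlam hG hGγ hrR.le rfl
  set L := 2 * (lam * (γ * ∫ x in (0 : ℝ)..T, |a x|))
  have hW : ∫ x in (0 : ℝ)..T, h x (v x) = 0 := by
    set W := ∫ x in (0 : ℝ)..T, h x (v x)
    rcases lt_trichotomy W 0 with hneg | h0 | hpos
    · have hcL : L ≤ c := by
        by_contra! hlt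
        have h1 : c < min L (c - W) := lt_min hlt (by linarith)
        linarith [le_max_right (-L) (min L (c - W))]
      have : 0 ≤ W := intervalIntegral.integral_nonneg hT.le fun x hx => by
        have h1 := (abs_le.1 (hvL x hx)).1
        rw [← hh0 x]
        exact (hh1 x).monotone (by linarith)
      linarith
    · exact h0
    · have hcL : c ≤ -L := by
        by_contra! hlt
        have h1 := max_lt hlt ((min_le_right L (c - W)).trans_lt (sub_lt_self c hpos))
        linarith
      have : 0 ≤ ∫ x in (0 : ℝ)..T, -h x (v x) :=
        intervalIntegral.integral_nonneg hT.le fun x hx => by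
          have h1 := (abs_le.1 (hvL x hx)).2
          have h2 := (hh1 x).monotone (show v x ≤ 0 by linarith)
          rw [hh0] at h2; linarith
      rw [intervalIntegral.integral_neg] at this
      linarith
  have huT : u T = u 0 := by
    have := hu T (right_mem_Icc.2 hT.le)
    rw [hW] at this; linarith
  obtain ⟨U, hUc, hUp, hUu⟩ := exists_periodic_extension hT huc huT.symm
  obtain ⟨V, hVc, hVp, hVv⟩ := exists_periodic_extension hT hvc hvT.symm
  have h0mem : (0 : ℝ) ∈ Icc 0 T := left_mem_Icc.2 hT.le
  have hsub : ∀ t ∈ Icc 0 T, uIcc 0 t ⊆ Icc 0 T := fun t ht => uIcc_subset_Icc h0mem ht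
  have H : IsForcedSol T lam β h a G U V := by
    refine ⟨hUc, hVc, hUp, hVp, ?_, ?_⟩
    · refine hUp.sub_eq_integral hT (fun t => by rw [hVp t, hhper])
        (fun s t => (hhc.comp (continuous_id.prodMk hVc)).intervalIntegrable s t) fun t ht => ?_
      rw [hUu ht, hUu h0mem, hu t ht]
      exact intervalIntegral.integral_congr fun x hx => by
        simp only [hVv (hsub t ht hx)]
    · have h1 : ∀ s t, IntervalIntegrable (fun x => max (a x) 0) volume s t := fun s t =>
        ⟨(ha s t).1.pos_part, (ha s t).2.pos_part⟩
      refine hVp.sub_eq_integral hT (fun t => by simp only [hap t, hUp t])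
        (fun s t => ((((ha s t).mul_continuousOn (hG.comp hUc).continuousOn).const_mul lam).add
          ((h1 s t).const_mul β)).neg) fun t ht => ?_
      rw [hVv ht, hVv h0mem, hv t]
      exact intervalIntegral.integral_congr fun x hx => by
        simp only [hUu (hsub t ht hx)]
  have hUM : ∀ t, U t ≤ M := fun t => by
    obtain ⟨y, hy, hyt⟩ := hUp.exists_mem_Ico₀ hT t
    rw [hyt, hUu (Ico_subset_Icc_self hy)]
    exact huM y
  have hUtm : U tm = M := (hUu htm).trans hutm
  have hβ : β = 0 := by
    rcases lt_trichotomy β 0 with hneg | h0 | hpos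
    · have hMr : M = r := by
        rw [min_eq_right (by linarith [hM.2])] at hMeq
        rcases max_choice r (M + β) with e | e <;> linarith
      rw [hMr] at hUM hUtm
      exact absurd (hsmall β U V H hUM ⟨tm, hUtm⟩) (not_lt.2 hneg.le)
    · exact h0
    · have hMR : M = R := by
        rcases min_choice R (M + β) with e | e <;> rw [e] at hMeq
        · rw [hMeq, max_eq_right hrR.le]
        · linarith [le_max_right r (M + β)]
      rw [hMR] at hUM hUtm
      exact (hlarge β hpos.le U V H hUM ⟨tm, hUtm⟩).elim
  exact ⟨U, V, hβ ▸ H, tm, by rw [hUtm]; exact hr.trans_le hM.1⟩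

/-- A sign-changing weight has a positive part with positive integral over a period. -/
theorem SignChanging.integral_pos_part_pos {T : ℝ} {a : ℝ → ℝ} {N : ℕ} {σ τ : Fin (N + 1) → ℝ}
    (hstar : SignChanging T a N σ τ) (ha : ∀ s t, IntervalIntegrable a volume s t)
    (hap : Function.Periodic a T) : 0 < ∫ x in (0 : ℝ)..T, max (a x) 0 := by
  obtain ⟨hστ, -, hτT, hpos, -⟩ := hstar
  have hp : ∀ s t, IntervalIntegrable (fun x => max (a x) 0) volume s t := fun s t =>
    ⟨(ha s t).1.pos_part, (ha s t).2.pos_part⟩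
  have hpp : Function.Periodic (fun x => max (a x) 0) T := fun x => by simp only [hap x]
  obtain ⟨α, hα, hle⟩ := exists_pos_forall_le_integral ha (sub_pos.2 (hστ 0)) (hpos 0)
  have h1 := hle (σ 0) le_rfl (by linarith)
  rw [add_sub_cancel] at h1
  calc 0 < α := hα
    _ ≤ ∫ x in σ 0..τ 0, a x := h1
    _ ≤ ∫ x in σ 0..τ 0, max (a x) 0 :=
        intervalIntegral.integral_mono_on (hστ 0).le (ha _ _) (hp _ _) fun x _ => le_max_left _ _
    _ ≤ ∫ x in σ 0..σ 0 + T, max (a x) 0 :=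
        intervalIntegral.integral_mono_interval le_rfl (hστ 0).le (hτT 0).le
          (ae_of_all _ fun x => le_max_right _ _) (hp _ _)
    _ = _ := by rw [hpp.intervalIntegral_add_eq (σ 0) 0, zero_add]

/-- Regular oscillation at zero, in terms of relative increments. -/
theorem RegOscZero.exists_abs_sub_le {g : ℝ → ℝ} (hreg : RegOscZero g)
    (hgpos : ∀ s, 0 < s → 0 < g s) {η : ℝ} (hη : 0 < η) :
    ∃ δ > 0, ∃ s₁ > 0, δ < 1 ∧ ∀ r, 0 < r → r < s₁ → ∀ x, (1 - δ) * r ≤ x → x ≤ r →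
      |g x - g r| ≤ η * g r := by
  have h1 := (Metric.tendsto_nhds.1 hreg) η hη
  rw [eventually_prod_iff] at h1
  obtain ⟨p, hp, q, hq, hpq⟩ := h1
  obtain ⟨δ, hδ, hp⟩ := Metric.eventually_nhds_iff.1 hp
  obtain ⟨s₁, hs₁, hq⟩ := mem_nhdsGT_iff_exists_Ioo_subset.1 hq
  refine ⟨min δ 1 / 2, by positivity, s₁, hs₁,
    by linarith [min_le_right δ 1], fun r hr hrs x hx1 hx2 => ?_⟩
  have h2 : p (x / r) := by
    apply hp
    have h3 : x / r ≤ 1 := (div_le_one hr).2 hx2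
    have h4 : 1 - min δ 1 / 2 ≤ x / r := (le_div_iff₀ hr).2 hx1
    rw [Real.dist_eq, abs_of_nonpos (by linarith)]
    linarith [min_le_left δ 1, lt_min hδ one_pos]
  have h3 := hpq h2 (hq ⟨hr, hrs⟩)
  have hg := hgpos r hr
  simp only [div_mul_cancel₀ _ hr.ne', Real.dist_eq] at h3
  rw [div_sub_one hg.ne', abs_div, abs_of_pos hg, div_lt_iff₀ hg] at h3
  exact h3.le

theorem statement0
    (T : ℝ) (hT : 0 < T)
    (h : ℝ → ℝ → ℝ) (hhc : Continuous (Function.uncurry h))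
    (hhper : ∀ t s : ℝ, h (t + T) s = h t s)
    (hh0 : ∀ t : ℝ, h t 0 = 0)
    (hh1 : ∀ t : ℝ, StrictMono (h t))
    (a : ℝ → ℝ) (haloc : LocallyIntegrable a volume)
    (haper : Function.Periodic a T)
    (haneg : (∫ t in (0:ℝ)..T, a t) < 0)
    (N : ℕ) (σ τ : Fin (N + 1) → ℝ) (hstar : SignChanging T a N σ τ)
    (g : ℝ → ℝ) (hgc : ContinuousOn g (Set.Ici 0))
    (hg0 : g 0 = 0) (hgpos : ∀ s : ℝ, 0 < s → 0 < g s)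
    (hreg : RegOscZero g)
    (hzero : ∀ K : ℝ, TendstoUniformly (fun s t => h t (K * g s) / s)
      (fun _ => 0) (nhdsWithin 0 (Set.Ioi 0))) :
    ∃ lam0 : ℝ, 0 < lam0 ∧ ∀ lam : ℝ, lam0 < lam →
      ∃ u v : ℝ → ℝ,
        IsPeriodicSol T h (fun t x => -(lam * a t * g x)) u v ∧ ∀ t, 0 < u t := by
  have ha : ∀ s t, IntervalIntegrable a volume s t := fun s t =>
    (haloc.integrableOn_isCompact isCompact_uIcc).intervalIntegrable
  set G : ℝ → ℝ := fun x => g (max x 0)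
  have hG : Continuous G := hgc.comp_continuous (continuous_id.max continuous_const)
    fun x => le_max_right x 0
  have hGg : ∀ x, 0 < x → G x = g x := fun x hx => by simp only [G, max_eq_left hx.le]
  have hG0 : ∀ x ≤ 0, G x = 0 := fun x hx => by simp only [G, max_eq_right hx, hg0]
  have hGpos : ∀ x, 0 < x → 0 < G x := fun x hx => by rw [hGg x hx]; exact hgpos x hx
  have hzero' : ∀ K ε : ℝ, 0 < ε →
      ∃ s₀ > 0, ∀ s, 0 < s → s < s₀ → ∀ t, |h t (K * G s)| ≤ ε * s := fun K ε hε => by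
    have h1 := Metric.tendstoUniformly_iff.1 (hzero K) ε hε
    obtain ⟨s₀, hs₀, hs⟩ := mem_nhdsGT_iff_exists_Ioo_subset.1 h1
    refine ⟨s₀, hs₀, fun s hs1 hs2 t => ?_⟩
    have h2 := hs ⟨hs1, hs2⟩ t
    rw [dist_comm, Real.dist_eq, sub_zero, abs_div, abs_of_pos hs1, div_lt_iff₀ hs1] at h2
    rw [hGg s hs1]
    exact h2.le
  have hosc : ∀ η > 0, ∃ δ > 0, ∃ s₁ > 0, ∀ r, 0 < r → r < s₁ → ∀ x, (1 - δ) * r ≤ x → x ≤ r →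
      |G x - G r| ≤ η * G r := fun η hη => by
    obtain ⟨δ, hδ, s₁, hs₁, hδ1, hg⟩ := hreg.exists_abs_sub_le hgpos hη
    refine ⟨δ, hδ, s₁, hs₁, fun r hr hrs x hx1 hx2 => ?_⟩
    have hx0 : 0 < x := lt_of_lt_of_le (mul_pos (by linarith) hr) hx1
    rw [hGg x hx0, hGg r hr]
    exact hg r hr hrs x hx1 hx2
  have hapos := hstar.integral_pos_part_pos ha haper
  obtain ⟨R, hR, lam0, hlam0, hlarge⟩ :=
    IsForcedSol.exists_large hT hhc hhper hh0 hh1 ha hstar hG hG0 hGpos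
  refine ⟨lam0, hlam0, fun lam hlam => ?_⟩
  have hlam_pos : 0 < lam := hlam0.trans hlam
  obtain ⟨r, hr, hrR, hsmall⟩ := IsForcedSol.exists_small hT hhc hh0 hh1 ha haper haneg hapos
    hlam_pos hG hG0 hGpos hzero' hosc hR
  obtain ⟨u, v, H, tp, htp⟩ := exists_isForcedSol_zero hT hhc hhper hh0 hh1 ha haper hapos
    hlam_pos.le hG hG0 hr hrR hsmall (hlarge lam hlam)
  have hu : ∀ t, 0 < u t := H.fst_pos hT hhc hh0 hh1 ha haper hlam_pos.le hG (hG0 0 le_rfl) hGpos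
    hzero' (H.fst_nonneg hT hhc hh0 hh1 hG0 le_rfl htp) htp
  have heq : ∀ t, -(lam * (a t * G (u t)) + 0 * max (a t) 0) = -(lam * a t * g (u t)) :=
    fun t => by rw [hGg _ (hu t)]; ring
  refine ⟨u, v, ⟨H.continuous_fst, H.continuous_snd, H.periodic_fst, H.periodic_snd,
    H.intervalIntegrable_fst hhc, fun s t => ?_, fun t => ?_, fun t => ?_⟩, hu⟩
  · simpa only [heq] using H.intervalIntegrable_snd ha hG s t
  · rw [← H.fst_sub]; ring
  · simp only [← heq]
    rw [← H.snd_sub]; ring
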